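/- arXiv:1506.06842 — 2 statements merged into one kernel-verified Lean document; each statement's English description precedes it below -/
import Mathlib

section
/- Let ψ : ℝ → ℝ be smooth with compact support in (0,∞) and ψ̂(v) = ∫_ℝ ψ(u) e^{2πiuv} du. Then 2 Re ∫_y^∞ ⌊v/y⌋ ψ̂(v) dv/v → ∫_0^∞ (log(uy) + γ) ψ(u) du + o(1)-correction, precisely: 2 Re ∫_y^∞ ⌊v/y⌋ ψ̂(v) dv/v − ∫_0^∞ (log(uy) + γ) ψ(u) du → 0 as y → 0⁺. -/
open Complex Real MeasureTheory Filter

noncomputable def GG (ψ : ℝ → ℝ) (v : ℝ) : ℂ :=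
  ∫ u : ℝ, (ψ u : ℂ) * Complex.exp (2 * Real.pi * Complex.I * u * v)

open scoped FourierTransform SchwartzMap in
lemma GG_schwartz (ψ : ℝ → ℝ) (hψ : ContDiff ℝ (⊤ : ℕ∞) ψ) (hsupp : HasCompactSupport ψ) :
    ∃ f : 𝓢(ℝ, ℂ), (∀ u, f u = ψ u) ∧ ∀ v, GG ψ v = 𝓕 f (-v) := by
  have h1 : HasCompactSupport (fun u => (ψ u : ℂ)) := hsupp.comp_left (g := fun x : ℝ => (x : ℂ)) (by simp)
  have h2 : ContDiff ℝ (⊤ : ℕ∞) (fun u => (ψ u : ℂ)) := Complex.ofRealCLM.contDiff.comp hψ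
  refine ⟨h1.toSchwartzMap h2, fun u => rfl, fun v => ?_⟩
  rw [SchwartzMap.fourier_coe, Real.fourier_real_eq_integral_exp_smul]
  unfold GG
  congr 1
  ext u
  simp only [smul_eq_mul]
  rw [mul_comm]
  congr 2
  push_cast; ring

lemma GG_bound (ψ : ℝ → ℝ) (hψ : ContDiff ℝ (⊤ : ℕ∞) ψ) (hsupp : HasCompactSupport ψ) :
    Continuous (GG ψ) ∧ ∃ C, 0 ≤ C ∧ ∀ v, v ^ 2 * ‖GG ψ v‖ ≤ C := by
  obtain ⟨f, -, hf⟩ := GG_schwartz ψ hψ hsupp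
  refine ⟨?_, ?_⟩
  · rw [funext hf]
    exact (SchwartzMap.continuous _).comp continuous_neg
  · obtain ⟨C, hC, h⟩ := SchwartzMap.decay (FourierTransform.fourier f) 2 0
    refine ⟨C, hC.le, fun v => ?_⟩
    have := h (-v)
    simpa [hf] using this

lemma GG_neg (ψ : ℝ → ℝ) (v : ℝ) : GG ψ (-v) = (starRingEnd ℂ) (GG ψ v) := by
  unfold GG
  rw [← integral_conj]
  congr 1
  ext u
  have : (starRingEnd ℂ) 2 = 2 := Complex.conj_ofNat 2
  simp [← Complex.exp_conj, this]

lemma GG_zero (ψ : ℝ → ℝ) : GG ψ 0 = ((∫ u, ψ u : ℝ) : ℂ) := by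
  unfold GG
  rw [← integral_complex_ofReal]
  simp

lemma GG_scale (ψ : ℝ → ℝ) {s : ℝ} (hs : 0 < s) (v : ℝ) :
    GG (fun u => ψ (u / s)) v = s * GG ψ (s * v) := by
  unfold GG
  have := Measure.integral_comp_div (fun u : ℝ => (ψ u : ℂ) * Complex.exp (2 * Real.pi * Complex.I * u * ((s * v : ℝ) : ℂ))) s
  rw [abs_of_pos hs] at this
  rw [← Complex.real_smul, ← this]
  congr 1
  ext u
  congr 2
  have : (s : ℂ) ≠ 0 := by exact_mod_cast hs.ne'
  push_cast
  field_simp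

lemma summable_of_decay {G : ℝ → ℂ} {C : ℝ} (hG : ∀ v, v ^ 2 * ‖G v‖ ≤ C) {s : ℝ} (hs : 0 < s) :
    Summable (fun n : ℕ => G ((n + 1) * s)) := by
  have h := ((summable_nat_add_iff 1).mpr (Real.summable_one_div_nat_pow.mpr one_lt_two)).mul_left (C / s ^ 2)
  refine Summable.of_norm_bounded h fun n => ?_
  have h1 := hG ((n + 1) * s)
  have : 0 < (((n : ℝ) + 1) * s) ^ 2 := by positivity
  push_cast
  rw [div_mul_div_comm, mul_one, le_div_iff₀ (by positivity)]
  linarith [mul_pow ((n : ℝ) + 1) s 2, mul_comm (s ^ 2 * ((n : ℝ) + 1) ^ 2) ‖G ((n + 1) * s)‖, mul_comm (s^2) (((n : ℝ) + 1) ^ 2)]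

lemma summable_psi (ψ : ℝ → ℝ) (hsupp : HasCompactSupport ψ) :
    Summable (fun n : ℕ => ψ (n + 1)) := by
  obtain ⟨M, hM⟩ := hsupp.isCompact.isBounded.subset_closedBall 0
  refine summable_of_ne_finset_zero (s := Finset.range (⌈M⌉₊)) fun n hn => ?_
  by_contra h
  have := hM (subset_tsupport _ h)
  simp only [Metric.mem_closedBall, dist_zero_right, Real.norm_eq_abs] at this
  have h2 := Nat.le_ceil M
  simp at hn
  rw [abs_of_nonneg (by positivity)] at this
  have : M < M := by linarith
  exact this.false

lemma poisson_one (ψ : ℝ → ℝ) (hψ : ContDiff ℝ (⊤ : ℕ∞) ψ) (hsupp : HasCompactSupport ψ)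
    (hpos : tsupport ψ ⊆ Set.Ioi 0) :
    2 * ∑' n : ℕ, (GG ψ (n + 1)).re = (∑' n : ℕ, ψ (n + 1)) - ∫ u, ψ u := by
  obtain ⟨f, hf, hF⟩ := GG_schwartz ψ hψ hsupp
  obtain ⟨-, C, -, hC⟩ := GG_bound ψ hψ hsupp
  have hneg : ∀ u ≤ 0, ψ u = 0 := fun u hu => by
    by_contra h
    exact absurd (hpos (subset_tsupport _ h)) (by simpa using hu)
  have h := SchwartzMap.tsum_eq_tsum_fourier f 0
  simp only [zero_add, hf] at h
  have hS := summable_of_decay hC one_pos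
  simp only [mul_one] at hS
  have hS' : Summable (fun n : ℕ => GG ψ (-(n + 1))) := by
    simp only [GG_neg]
    exact hS.map (starRingEnd ℂ) Complex.continuous_conj
  have e1 : ∀ n : ℤ, FourierTransform.fourier f (n : ℝ) * (fourier n ((0 : ℝ) : UnitAddCircle)) = GG ψ (-n) := by
    intro n
    rw [hF]; simp
  simp only [e1] at h
  have hp := summable_psi ψ hsupp
  have hpc : Summable (fun n : ℕ => ((ψ (n + 1) : ℝ) : ℂ)) := Complex.ofRealCLM.summable hp
  rw [tsum_of_add_one_of_neg_add_one (f := fun n : ℤ => ((ψ n : ℝ) : ℂ)),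
    tsum_of_add_one_of_neg_add_one (f := fun n : ℤ => GG ψ (-n))] at h
  · push_cast at h
    have z : ∀ n : ℕ, ψ (-(n + 1 : ℝ)) = 0 := fun n => hneg _ (by linarith [(n.cast_nonneg : (0:ℝ) ≤ n)])
    have z' : ∀ n : ℕ, ψ (-1 + -(n : ℝ)) = 0 := fun n => hneg _ (by linarith [(n.cast_nonneg : (0:ℝ) ≤ n)])
    have h' := congrArg Complex.re h
    simp only [neg_neg, neg_zero, GG_zero, z, hneg 0 le_rfl, Complex.add_re, Complex.ofReal_zero, tsum_zero, add_zero, Complex.ofReal_re] at h'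
    rw [Complex.re_tsum hpc, Complex.re_tsum hS, Complex.re_tsum hS'] at h'
    simp only [GG_neg, Complex.conj_re, Complex.ofReal_re] at h'
    linarith
  · simpa using hS'
  · simpa using hS
  · simpa using hpc
  · refine summable_zero.congr fun n => ?_
    rw [hneg]; simp
    push_cast
    linarith [(n.cast_nonneg : (0:ℝ) ≤ n)]

lemma poisson_s (ψ : ℝ → ℝ) (hψ : ContDiff ℝ (⊤ : ℕ∞) ψ) (hsupp : HasCompactSupport ψ)
    (hpos : tsupport ψ ⊆ Set.Ioi 0) {s : ℝ} (hs : 0 < s) :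
    2 * ∑' n : ℕ, (GG ψ ((n + 1) * s)).re = (1 / s) * (∑' n : ℕ, ψ ((n + 1) / s)) - ∫ u, ψ u := by
  have hsup : tsupport (fun u => ψ (u / s)) ⊆ (fun u => u / s) ⁻¹' tsupport ψ := 
    tsupport_comp_subset_preimage ψ (f := fun u : ℝ => u / s) (by fun_prop)
  have h := poisson_one (fun u => ψ (u / s)) (hψ.comp (contDiff_id.div_const s))
    (by
      have := hsupp.comp_homeomorph (Homeomorph.mulRight₀ (s⁻¹) (by positivity))
      exact this)
    (by
      intro u hu
      have := hpos (hsup hu)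
      simp only [Set.mem_Ioi] at this ⊢
      exact (div_pos_iff_of_pos_right hs).mp this)
  rw [Measure.integral_comp_div, abs_of_pos hs] at h
  simp only [GG_scale _ hs, Complex.re_ofReal_mul, smul_eq_mul] at h
  rw [tsum_mul_left] at h
  simp only [mul_comm s (_ + 1 : ℝ)] at h
  field_simp
  linarith

lemma decay_div {F : ℝ → ℝ} {C : ℝ} (hC : ∀ v, v ^ 2 * |F v| ≤ C) {v : ℝ} (hv : 0 < v) :
    ‖F v / v‖ ≤ C * v ^ (-3 : ℝ) := by
  have e : v ^ (-3 : ℝ) = (v ^ 3)⁻¹ := by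
    rw [Real.rpow_neg hv.le]; norm_cast
  rw [e, norm_div, Real.norm_eq_abs, Real.norm_eq_abs, abs_of_pos hv, ← div_eq_mul_inv,
    div_le_div_iff₀ hv (by positivity)]
  nlinarith [mul_le_mul_of_nonneg_right (hC v) hv.le]

lemma tail_int {F : ℝ → ℝ} {C : ℝ} (hF : Continuous F) (hC : ∀ v, v ^ 2 * |F v| ≤ C) {a : ℝ}
    (ha : 0 < a) : IntegrableOn (fun v => F v / v) (Set.Ioi a) ∧
      ∫ v in Set.Ioi a, ‖F v / v‖ ≤ C / (2 * a ^ 2) := by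
  have h3 : IntegrableOn (fun v : ℝ => C * v ^ (-3 : ℝ)) (Set.Ioi a) :=
    (integrableOn_Ioi_rpow_of_lt (by norm_num) ha).const_mul C
  have hb : ∀ᵐ v ∂(volume.restrict (Set.Ioi a)), ‖F v / v‖ ≤ C * v ^ (-3 : ℝ) := by
    filter_upwards [ae_restrict_mem measurableSet_Ioi] with v hv
    exact decay_div hC (ha.trans hv)
  have hi : IntegrableOn (fun v => F v / v) (Set.Ioi a) :=
    Integrable.mono' h3 (hF.measurable.div measurable_id).aestronglyMeasurable hb
  refine ⟨hi, (integral_mono_ae hi.norm h3 hb).trans ?_⟩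
  rw [integral_const_mul, integral_Ioi_rpow_of_lt (by norm_num) ha]
  have : a ^ (-3 + 1 : ℝ) = (a ^ 2)⁻¹ := by
    rw [show (-3 + 1 : ℝ) = -(2 : ℕ) by norm_num, Real.rpow_neg ha.le, Real.rpow_natCast]
  rw [this]
  apply le_of_eq
  field_simp
  norm_num

lemma sum_sq_summable (c : ℝ) : Summable (fun n : ℕ => c / ((n : ℝ) + 1) ^ 2) := by
  have h := ((summable_nat_add_iff 1).mpr (Real.summable_one_div_nat_pow.mpr one_lt_two)).mul_left c
  refine h.congr fun n => ?_
  push_cast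
  ring

lemma floor_ind {y v : ℝ} (hy : 0 < y) (hv : 0 < v) (c : ℝ) :
    ∑' n : ℕ, (Set.Ici ((n + 1 : ℝ) * y)).indicator (fun _ => c) v = (⌊v / y⌋ : ℝ) * c := by
  have hz : (⌊v / y⌋₊ : ℤ) = ⌊v / y⌋ := Int.natCast_floor_eq_floor (by positivity)
  rw [← hz, tsum_eq_sum (s := Finset.range ⌊v / y⌋₊)]
  · rw [Finset.sum_congr rfl (g := fun _ => c)]
    · simp
    · intro n hn
      rw [Set.indicator_of_mem]
      have : n + 1 ≤ ⌊v / y⌋₊ := by simpa using hn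
      have := (Nat.le_floor_iff (by positivity)).mp this
      rw [le_div_iff₀ hy] at this
      push_cast at this
      exact this
  · intro n hn
    rw [Set.indicator_of_notMem]
    intro h
    apply hn
    have h : ((n + 1 : ℕ) : ℝ) ≤ v / y := by
      rw [le_div_iff₀ hy]; push_cast; exact h
    have := Nat.le_floor h
    simpa using this

lemma unfold_floor {F : ℝ → ℝ} {C : ℝ} (hF : Continuous F) (hC : ∀ v, v ^ 2 * |F v| ≤ C) {y : ℝ}
    (hy : 0 < y) :
    ∫ v in Set.Ioi y, (⌊v / y⌋ : ℝ) * (F v / v) =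
      ∫ s in Set.Ioi y, ∑' n : ℕ, F ((n + 1) * s) / s := by
  have hpos : ∀ n : ℕ, 0 < (n : ℝ) + 1 := fun n => by positivity
  have key : ∀ g : ℝ → ℝ, ∀ n : ℕ, ∫ s in Set.Ioi y, g ((n + 1) * s) / s =
      ∫ v in Set.Ioi y, (Set.Ici ((n + 1 : ℝ) * y)).indicator (fun v => g v / v) v := by
    intro g n
    have h := integral_comp_mul_left_Ioi (fun v => g v / v) y (hpos n)
    rw [setIntegral_indicator measurableSet_Ici]
    have hs : (Set.Ioi y ∩ Set.Ici ((n + 1 : ℝ) * y) : Set ℝ) =ᵐ[volume] Set.Ioi ((n + 1 : ℝ) * y) := by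
      refine Filter.EventuallyEq.trans ?_ Ioi_ae_eq_Ici.symm
      rcases Nat.eq_zero_or_pos n with rfl | hn
      · simp only [Nat.cast_zero, zero_add, one_mul]
        rw [Set.inter_eq_left.mpr Set.Ioi_subset_Ici_self]
        exact Ioi_ae_eq_Ici
      · rw [Set.inter_eq_right.mpr]
        · exact ae_eq_refl _
        intro v hv
        have : (0 : ℝ) < n := by exact_mod_cast hn
        have hv' : (n + 1 : ℝ) * y ≤ v := hv
        show y < v
        nlinarith
    rw [setIntegral_congr_set hs]
    have h2 : ∫ s in Set.Ioi y, g ((n + 1) * s) / s =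
        (n + 1) * ∫ s in Set.Ioi y, g ((n + 1) * s) / ((n + 1) * s) := by
      rw [← integral_const_mul]
      congr 1
      ext s
      have := (hpos n).ne'
      rw [← mul_div_assoc, mul_div_mul_left _ _ this]
    rw [h2, h, smul_eq_mul, mul_inv_cancel_left₀ (hpos n).ne']
  have hsum : Summable (fun n : ℕ => ∫ v in Set.Ioi ((n + 1 : ℝ) * y), ‖F v / v‖) := by
    refine Summable.of_nonneg_of_le (fun n => integral_nonneg fun _ => norm_nonneg _)
      (fun n => (tail_int hF hC (mul_pos (hpos n) hy)).2) ?_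
    refine (sum_sq_summable (C / (2 * y ^ 2))).congr fun n => ?_
    rw [div_div]
    congr 1; ring
  -- right-hand side terms
  have hA : ∀ n : ℕ, Integrable (fun s => F ((n + 1) * s) / s) (volume.restrict (Set.Ioi y)) := by
    intro n
    have hc : ∀ v, v ^ 2 * |F ((n + 1) * v)| ≤ C / (n + 1) ^ 2 := fun v => by
      rw [le_div_iff₀ (by have := hpos n; positivity)]
      have := hC ((n + 1) * v)
      nlinarith
    exact (tail_int (F := fun v => F ((n + 1) * v)) (by fun_prop) hc hy).1
  have hIe : ∀ n : ℕ, (fun v => ‖(Set.Ici ((n + 1 : ℝ) * y)).indicator (fun v => F v / v) v‖) =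
      (Set.Ici ((n + 1 : ℝ) * y)).indicator (fun v => ‖F v / v‖) := fun n => by
    ext v; rw [norm_indicator_eq_indicator_norm]
  have hsub : ∀ n : ℕ, ∫ v in Set.Ioi y, (Set.Ici ((n + 1 : ℝ) * y)).indicator (fun v => ‖F v / v‖) v =
      ∫ v in Set.Ioi ((n + 1 : ℝ) * y), ‖F v / v‖ := by
    intro n
    rw [setIntegral_indicator measurableSet_Ici]
    apply setIntegral_congr_set
    refine Filter.EventuallyEq.trans ?_ Ioi_ae_eq_Ici.symm
    refine Filter.EventuallyEq.trans (Filter.EventuallyEq.inter Ioi_ae_eq_Ici (ae_eq_refl _)) ?_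
    rw [Set.inter_eq_right.mpr]
    · exact ae_eq_refl _
    apply Set.Ici_subset_Ici.mpr
    have : (0 : ℝ) ≤ n := by positivity
    nlinarith
  have hB : ∀ n : ℕ, Integrable ((Set.Ici ((n + 1 : ℝ) * y)).indicator (fun v => F v / v))
      (volume.restrict (Set.Ioi y)) := fun n =>
    Integrable.indicator (tail_int hF hC hy).1 measurableSet_Ici
  have h1 := hasSum_integral_of_summable_integral_norm hB (by simpa only [hIe, hsub] using hsum)
  have hAn : ∀ n : ℕ, ∫ s in Set.Ioi y, ‖F ((n + 1) * s) / s‖ =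
      ∫ v in Set.Ioi ((n + 1 : ℝ) * y), ‖F v / v‖ := by
    intro n
    have e : ∀ g : ℝ → ℝ, ∀ a : ℝ, y ≤ a → ∫ s in Set.Ioi a, ‖g s / s‖ = ∫ s in Set.Ioi a, |g s| / s := by
      intro g a ha
      refine setIntegral_congr_fun measurableSet_Ioi fun s hs => ?_
      have : 0 < s := hy.trans_le (ha.trans (le_of_lt hs))
      simp only [norm_div, Real.norm_eq_abs, abs_of_pos this]
    have hle : y ≤ (n + 1 : ℝ) * y := by
      have : (0 : ℝ) ≤ n := by positivity
      nlinarith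
    rw [e (fun s => F ((n + 1) * s)) y le_rfl, key (fun v => |F v|) n, ← hsub n]
    refine setIntegral_congr_fun measurableSet_Ioi fun s hs => ?_
    have : 0 < s := hy.trans hs
    simp only [Set.indicator, norm_div, Real.norm_eq_abs, abs_of_pos this]
  have h2 := hasSum_integral_of_summable_integral_norm hA (by simpa only [hAn] using hsum)
  simp only [key F] at h2
  rw [← h2.tsum_eq, h1.tsum_eq]
  refine setIntegral_congr_fun measurableSet_Ioi fun v hv => ?_
  have := floor_ind hy (hy.trans hv) (F v / v)
  simp only [← this]
  rfl

lemma tsum_integrable {F : ℝ → ℝ} {C : ℝ} (hF : Continuous F) (hC : ∀ v, v ^ 2 * |F v| ≤ C) {y : ℝ}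
    (hy : 0 < y) : IntegrableOn (fun s => ∑' n : ℕ, F ((n + 1) * s) / s) (Set.Ioi y) := by
  have hC0 : 0 ≤ C := by simpa using hC 0
  have hc : ∀ n : ℕ, ∀ v, v ^ 2 * |F ((n + 1) * v)| ≤ C / (n + 1) ^ 2 := fun n v => by
    rw [le_div_iff₀ (by positivity)]
    have := hC ((n + 1) * v)
    nlinarith
  have hb : ∀ n : ℕ, ∀ s, 0 < s → ‖F ((n + 1) * s) / s‖ ≤ C / (n + 1) ^ 2 * s ^ (-3 : ℝ) := fun n s hs =>
    decay_div (F := fun v => F ((n + 1) * v)) (hc n) hs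
  have hcont : ContinuousOn (fun s => ∑' n : ℕ, F ((n + 1) * s) / s) (Set.Ioi y) := by
    refine continuousOn_tsum (u := fun n : ℕ => C / (n + 1) ^ 2 * y ^ (-3 : ℝ)) ?_
      ((sum_sq_summable C).mul_right _) ?_
    · intro n
      refine ContinuousOn.div (by fun_prop) continuousOn_id fun s hs => (hy.trans hs).ne'
    · intro n s hs
      refine (hb n s (hy.trans hs)).trans ?_
      gcongr ?_ * ?_
      exact Real.rpow_le_rpow_of_nonpos hy (le_of_lt hs) (by norm_num)
  refine Integrable.mono' (g := fun s => (∑' n : ℕ, C / ((n : ℝ) + 1) ^ 2) * s ^ (-3 : ℝ)) ?_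
    (hcont.aestronglyMeasurable measurableSet_Ioi) ?_
  · exact (integrableOn_Ioi_rpow_of_lt (by norm_num) hy).const_mul _
  · filter_upwards [ae_restrict_mem measurableSet_Ioi] with s hs
    rw [← tsum_mul_right]
    exact tsum_of_norm_bounded ((sum_sq_summable C).mul_right _).hasSum fun n => hb n s (hy.trans hs)

lemma term_int (ψ : ℝ → ℝ) (hψ : Continuous ψ) {M y S c : ℝ} (hM : ∀ u, M < u → ψ u = 0)
    (hy : 0 < y) (hyS : y ≤ S) (hc : 1 ≤ c) (hyM : M ≤ 1 / y) :
    ∫ s in y..S, ψ (c / s) / s ^ 2 = ∫ u, (Set.Ici (c / S)).indicator (fun u => c⁻¹ * ψ u) u := by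
  have hS : 0 < S := hy.trans_le hyS
  have hc0 : 0 < c := by linarith
  have hd : ∀ s ∈ Set.uIcc y S, HasDerivAt (fun s => -c⁻¹ * ∫ u in (0:ℝ)..(c / s), ψ u)
      (ψ (c / s) / s ^ 2) s := by
    intro s hs
    rw [Set.uIcc_of_le hyS] at hs
    have hs0 : 0 < s := hy.trans_le hs.1
    have h1 : HasDerivAt (fun x => ∫ u in (0:ℝ)..x, ψ u) (ψ (c / s)) (c / s) :=
      intervalIntegral.integral_hasDerivAt_right (hψ.intervalIntegrable _ _)
        (hψ.stronglyMeasurableAtFilter _ _) hψ.continuousAt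
    have h2 : HasDerivAt (fun s : ℝ => c / s) (c * (-(s ^ 2)⁻¹)) s := by
      simpa only [div_eq_mul_inv] using (hasDerivAt_inv hs0.ne').const_mul c
    have h3 := (h1.comp s h2).const_mul (-c⁻¹)
    refine h3.congr_deriv ?_
    field_simp
  have hcont : ContinuousOn (fun s => ψ (c / s) / s ^ 2) (Set.uIcc y S) := by
    rw [Set.uIcc_of_le hyS]
    have hne : ∀ s ∈ Set.Icc y S, s ≠ 0 := fun s hs => (hy.trans_le hs.1).ne'
    refine ContinuousOn.div ?_ (by fun_prop) fun s hs => pow_ne_zero _ (hne s hs)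
    exact hψ.comp_continuousOn (continuousOn_const.div continuousOn_id hne)
  rw [intervalIntegral.integral_eq_sub_of_hasDerivAt hd hcont.intervalIntegrable]
  rw [integral_indicator measurableSet_Ici, integral_const_mul, integral_Ici_eq_integral_Ioi]
  have hle : c / S ≤ c / y := by gcongr
  have h4 : ∫ u in Set.Ioi (c / S), ψ u = ∫ u in (c / S)..(c / y), ψ u := by
    rw [intervalIntegral.integral_of_le hle]
    refine (setIntegral_eq_of_subset_of_forall_sdiff_eq_zero measurableSet_Ioi
      Set.Ioc_subset_Ioi_self ?_)
    intro u hu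
    apply hM
    have h5 : c / y < u := by
      by_contra h
      exact hu.2 ⟨hu.1, not_lt.mp h⟩
    have : 1 / y ≤ c / y := by gcongr
    linarith
  rw [h4, ← intervalIntegral.integral_interval_sub_left (hψ.intervalIntegrable 0 (c / y)) (hψ.intervalIntegrable 0 (c / S))]
  ring

lemma harm_ind {S u : ℝ} (hS : 0 < S) (hu : 0 < u) {N : ℕ} (hN : u * S ≤ N) (p : ℝ) :
    ∑ n ∈ Finset.range N, (Set.Ici (((n : ℝ) + 1) / S)).indicator (fun _ => ((n : ℝ) + 1)⁻¹ * p) u =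
      p * (harmonic ⌊u * S⌋₊ : ℝ) := by
  have hfl : ⌊u * S⌋₊ ≤ N := Nat.floor_le_of_le hN
  have hmem : ∀ n : ℕ, n < ⌊u * S⌋₊ ↔ ((n : ℝ) + 1) / S ≤ u := by
    intro n
    rw [div_le_iff₀ hS, ← Nat.succ_le_iff, Nat.le_floor_iff (by positivity)]
    push_cast
    rfl
  rw [← Finset.sum_subset (Finset.range_subset_range.mpr hfl)]
  · unfold harmonic
    push_cast
    rw [Finset.mul_sum]
    refine Finset.sum_congr rfl fun n hn => ?_
    rw [Set.indicator_of_mem, mul_comm]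
    exact (hmem n).mp (Finset.mem_range.mp hn)
  · intro n _ hn
    rw [Set.indicator_of_notMem]
    intro h
    exact hn (Finset.mem_range.mpr ((hmem n).mpr h))

lemma sum_int (ψ : ℝ → ℝ) (hψ : Continuous ψ) (hsupp : HasCompactSupport ψ) {M y S : ℝ}
    (hM : ∀ u, M < u → ψ u = 0) (h0 : ∀ u ≤ 0, ψ u = 0)
    (hy : 0 < y) (hyS : y ≤ S) (hyM : M ≤ 1 / y) :
    ∫ s in y..S, (1 / s) * (∑' n : ℕ, ψ ((n + 1) / s)) / s = ∫ u, ψ u * (harmonic ⌊u * S⌋₊ : ℝ) := by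
  have hS : 0 < S := hy.trans_le hyS
  obtain ⟨N, hN⟩ := exists_nat_ge (M * S)
  have e1 : ∫ s in y..S, (1 / s) * (∑' n : ℕ, ψ ((n + 1) / s)) / s =
      ∫ s in y..S, ∑ n ∈ Finset.range N, ψ (((n : ℝ) + 1) / s) / s ^ 2 := by
    refine intervalIntegral.integral_congr fun s hs => ?_
    rw [Set.uIcc_of_le hyS] at hs
    have hs0 : 0 < s := hy.trans_le hs.1
    rw [tsum_eq_sum (s := Finset.range N), ← Finset.sum_div]
    · field_simp
    · intro n hn
      apply hM
      have hn : (N : ℝ) ≤ n := by exact_mod_cast (by simpa using hn : N ≤ n)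
      rw [lt_div_iff₀ hs0]
      by_cases hM0 : 0 ≤ M
      · nlinarith [hs.2]
      · nlinarith [hs.1, (n.cast_nonneg : (0:ℝ) ≤ n)]
  rw [e1, intervalIntegral.integral_finsetSum]
  · rw [Finset.sum_congr rfl fun (n : ℕ) _ => term_int ψ hψ hM hy hyS (c := (n : ℝ) + 1)
      (by linarith [(n.cast_nonneg : (0:ℝ) ≤ n)]) hyM]
    rw [← integral_finsetSum]
    · congr 1
      ext u
      by_cases hu : 0 < u
      · by_cases huM : u ≤ M
        · rw [← harm_ind hS hu (N := N) (by nlinarith) (ψ u)]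
          rfl
        · simp [Set.indicator, hM u (not_le.mp huM)]
      · simp [Set.indicator, h0 u (not_lt.mp hu)]
    · intro n _
      exact ((hψ.integrable_of_hasCompactSupport hsupp).const_mul _).indicator measurableSet_Ici
  · intro n _
    refine ContinuousOn.intervalIntegrable ?_
    rw [Set.uIcc_of_le hyS]
    have hne : ∀ s ∈ Set.Icc y S, s ≠ 0 := fun s hs => (hy.trans_le hs.1).ne'
    refine ContinuousOn.div ?_ (by fun_prop) fun s hs => pow_ne_zero _ (hne s hs)
    exact hψ.comp_continuousOn (continuousOn_const.div continuousOn_id hne)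

lemma harm_lim {u : ℝ} (hu : 0 < u) :
    Tendsto (fun S : ℝ => (harmonic ⌊u * S⌋₊ : ℝ) - Real.log (u * S)) atTop
      (nhds Real.eulerMascheroniConstant) := by
  have hx : Tendsto (fun S : ℝ => u * S) atTop atTop := tendsto_id.const_mul_atTop hu
  suffices h : Tendsto (fun x : ℝ => (harmonic ⌊x⌋₊ : ℝ) - Real.log x) atTop
      (nhds Real.eulerMascheroniConstant) from h.comp hx
  have h1 := Real.tendsto_harmonic_sub_log.comp (tendsto_nat_floor_atTop (α := ℝ))
  have h2 : Tendsto (fun x : ℝ => Real.log ((⌊x⌋₊ : ℝ) / x)) atTop (nhds 0) := by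
    have := (Real.continuousAt_log one_ne_zero).tendsto.comp (tendsto_nat_floor_div_atTop (R := ℝ))
    rwa [Real.log_one] at this
  have h3 := h1.add h2
  rw [add_zero] at h3
  refine h3.congr' ?_
  filter_upwards [eventually_ge_atTop 1] with x hx
  have : (0 : ℝ) < ⌊x⌋₊ := by exact_mod_cast Nat.floor_pos.mpr hx
  simp only [Function.comp]
  rw [Real.log_div this.ne' (by linarith)]
  ring

lemma D_bound (ψ : ℝ → ℝ) {m S : ℝ} (hm : 0 < m) (h0 : ∀ u < m, ψ u = 0) (hS : 1 / m ≤ S) (u : ℝ) :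
    ‖ψ u * ((harmonic ⌊u * S⌋₊ : ℝ) - Real.log (u * S))‖ ≤ ‖ψ u‖ := by
  by_cases hu : u < m
  · simp [h0 u hu]
  · push Not at hu
    rw [div_le_iff₀ hm] at hS
    have hS0 : 0 < S := by
      by_contra h
      nlinarith
    have h1 : 1 ≤ u * S := by nlinarith
    have h2 := log_le_harmonic_floor (u * S) (by linarith)
    have h3 := harmonic_floor_le_one_add_log (u * S) h1
    rw [norm_mul]
    refine mul_le_of_le_one_right (norm_nonneg _) ?_
    rw [Real.norm_eq_abs, abs_le]
    constructor <;> linarith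

lemma D_meas (ψ : ℝ → ℝ) (hψ : Continuous ψ) (S : ℝ) :
    AEStronglyMeasurable (fun u => ψ u * ((harmonic ⌊u * S⌋₊ : ℝ) - Real.log (u * S))) volume := by
  have h1 : Measurable (fun u : ℝ => ⌊u * S⌋₊) := Nat.measurable_floor.comp (measurable_id.mul_const S)
  have h2 : Measurable (fun u : ℝ => (harmonic ⌊u * S⌋₊ : ℝ)) :=
    (measurable_from_nat (f := fun n => (harmonic n : ℝ))).comp h1
  exact (hψ.measurable.mul (h2.sub (Real.measurable_log.comp (measurable_id.mul_const S)))).aestronglyMeasurable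

lemma D_lim (ψ : ℝ → ℝ) (hψ : Continuous ψ) (hsupp : HasCompactSupport ψ) {m : ℝ} (hm : 0 < m)
    (h0 : ∀ u < m, ψ u = 0) :
    Tendsto (fun S : ℝ => ∫ u, ψ u * ((harmonic ⌊u * S⌋₊ : ℝ) - Real.log (u * S))) atTop
      (nhds (∫ u, ψ u * Real.eulerMascheroniConstant)) := by
  refine tendsto_integral_filter_of_dominated_convergence (fun u => ‖ψ u‖) ?_ ?_
    (hψ.integrable_of_hasCompactSupport hsupp).norm ?_
  · exact Eventually.of_forall fun S => D_meas ψ hψ S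
  · filter_upwards [eventually_ge_atTop (1 / m)] with S hS
    exact Eventually.of_forall fun u => D_bound ψ hm h0 hS u
  · refine Eventually.of_forall fun u => ?_
    by_cases hu : u < m
    · simp [h0 u hu]
    · exact (harm_lim (hm.trans_le (not_lt.mp hu))).const_mul _

lemma log_integrable (ψ : ℝ → ℝ) (hψ : Continuous ψ) (hsupp : HasCompactSupport ψ)
    (hpos : tsupport ψ ⊆ Set.Ioi 0) {c : ℝ} (hc : 0 < c) :
    Integrable (fun u => ψ u * Real.log (u * c)) := by
  rw [← integrableOn_iff_integrable_of_support_subset (s := tsupport ψ)]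
  · refine ContinuousOn.integrableOn_compact hsupp.isCompact ?_
    refine hψ.continuousOn.mul (ContinuousOn.log (by fun_prop) fun u hu => ?_)
    exact (mul_pos (hpos hu) hc).ne'
  · intro u hu
    refine subset_tsupport _ fun h => hu ?_
    simp [h]

lemma exists_bounds (ψ : ℝ → ℝ) (hsupp : HasCompactSupport ψ) (hpos : tsupport ψ ⊆ Set.Ioi 0) :
    ∃ m M : ℝ, 0 < m ∧ 0 < M ∧ (∀ u < m, ψ u = 0) ∧ ∀ u, M < u → ψ u = 0 := by
  rcases (tsupport ψ).eq_empty_or_nonempty with h | h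
  · refine ⟨1, 1, one_pos, one_pos, ?_, ?_⟩ <;>
    · intro u _
      exact image_eq_zero_of_notMem_tsupport (by simp [h])
  · obtain ⟨a, ha, hmin⟩ := hsupp.isCompact.exists_isMinOn h continuousOn_id
    obtain ⟨b, hb, hmax⟩ := hsupp.isCompact.exists_isMaxOn h continuousOn_id
    refine ⟨a, b, hpos ha, hpos hb, ?_, ?_⟩ <;>
    · intro u hu
      refine image_eq_zero_of_notMem_tsupport fun hu' => ?_
      have h1 := hmin hu'
      have h2 := hmax hu'
      simp only [id, Set.mem_ofPred_eq] at h1 h2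
      linarith

/-- For smooth `ψ` compactly supported in `(0,∞)`:
`2 Re ∫_y^∞ ⌊v/y⌋ ψ̂(v) dv/v − ∫_0^∞ (log(uy) + γ) ψ(u) du → 0` as `y → 0⁺`. -/
theorem floor_integral_asymptotic (ψ : ℝ → ℝ)
    (hψ : ContDiff ℝ (⊤ : ℕ∞) ψ) (hsupp : HasCompactSupport ψ)
    (hpos : tsupport ψ ⊆ Set.Ioi 0) :
    Tendsto (fun y : ℝ =>
        2 * (∫ v in Set.Ioi y,
            ((⌊v / y⌋ : ℤ) : ℂ) *
              (∫ u : ℝ, (ψ u : ℂ) * Complex.exp (2 * Real.pi * Complex.I * u * v)) / v).re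
          - ∫ u in Set.Ioi (0 : ℝ),
              (Real.log (u * y) + Real.eulerMascheroniConstant) * ψ u)
      (nhdsWithin 0 (Set.Ioi 0)) (nhds 0) := by
  obtain ⟨m, M, hm, hM0, hml, hMr⟩ := exists_bounds ψ hsupp hpos
  have hcψ : Continuous ψ := hψ.continuous
  have hiψ : Integrable ψ := hcψ.integrable_of_hasCompactSupport hsupp
  refine Tendsto.congr' (f₁ := fun _ => (0 : ℝ)) ?_ tendsto_const_nhds
  have hmem : Set.Ioo (0 : ℝ) (1 / M) ∈ nhdsWithin (0 : ℝ) (Set.Ioi 0) :=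
    Ioo_mem_nhdsGT (by positivity)
  filter_upwards [hmem] with y hy
  obtain ⟨hy0, hyM⟩ := hy
  have hyM' : M ≤ 1 / y := by
    rw [le_div_iff₀ hy0]
    rw [lt_div_iff₀ hM0] at hyM
    linarith
  obtain ⟨hGc, C, hC0, hC⟩ := GG_bound ψ hψ hsupp
  have hFc : Continuous (fun v => (GG ψ v).re) := Complex.continuous_re.comp hGc
  have hFC : ∀ v, v ^ 2 * |(GG ψ v).re| ≤ C := fun v =>
    (mul_le_mul_of_nonneg_left (Complex.abs_re_le_norm _) (sq_nonneg v)).trans (hC v)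
  -- pass to the real part
  have hre : (∫ v in Set.Ioi y, ((⌊v / y⌋ : ℤ) : ℂ) *
      (∫ u : ℝ, (ψ u : ℂ) * Complex.exp (2 * Real.pi * Complex.I * u * v)) / v).re =
      ∫ v in Set.Ioi y, (⌊v / y⌋ : ℝ) * ((GG ψ v).re / v) := by
    have hint : Integrable (fun v : ℝ => ((⌊v / y⌋ : ℤ) : ℂ) * GG ψ v / v)
        (volume.restrict (Set.Ioi y)) := by
      refine Integrable.mono' (g := fun v : ℝ => C / y * v ^ (-2 : ℝ)) ?_ ?_ ?_
      · exact (integrableOn_Ioi_rpow_of_lt (by norm_num) hy0).const_mul _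
      · have h1 : Measurable (fun v : ℝ => ((⌊v / y⌋ : ℤ) : ℂ)) :=
          (measurable_from_top (f := fun n : ℤ => (n : ℂ))).comp
            (Int.measurable_floor.comp (measurable_id.div_const y))
        exact ((h1.mul hGc.measurable).div Complex.measurable_ofReal).aestronglyMeasurable
      · filter_upwards [ae_restrict_mem measurableSet_Ioi] with v hv
        have hv0 : 0 < v := hy0.trans hv
        have e : v ^ (-2 : ℝ) = (v ^ 2)⁻¹ := by
          rw [Real.rpow_neg hv0.le]; norm_cast
        have hfl0 : (0 : ℝ) ≤ (⌊v / y⌋ : ℝ) := by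
          exact_mod_cast Int.floor_nonneg.mpr (by positivity)
        have hfl := Int.floor_le (v / y)
        rw [e, norm_div, norm_mul, Complex.norm_intCast, Complex.norm_real, Real.norm_eq_abs,
          abs_of_pos hv0, abs_of_nonneg hfl0]
        have h2 : ‖GG ψ v‖ ≤ C / v ^ 2 := by
          rw [le_div_iff₀ (by positivity)]
          linarith [hC v]
        calc (⌊v / y⌋ : ℝ) * ‖GG ψ v‖ / v ≤ (v / y) * (C / v ^ 2) / v := by gcongr
          _ = C / y * (v ^ 2)⁻¹ := by field_simp
    have h3 := integral_re hint
    simp only [RCLike.re_to_complex] at h3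
    change (∫ v in Set.Ioi y, ((⌊v / y⌋ : ℤ) : ℂ) * GG ψ v / v).re = _
    rw [← h3]
    congr 1
    ext v
    rw [Complex.div_ofReal_re, ← Complex.ofReal_intCast, Complex.re_ofReal_mul, mul_div_assoc]
  rw [hre, unfold_floor hFc hFC hy0]
  -- the limit of the truncated integrals
  have hInt := tsum_integrable hFc hFC hy0
  have hL1 := (intervalIntegral_tendsto_integral_Ioi y hInt tendsto_id).const_mul 2
  have hL2 := (D_lim ψ hcψ hsupp hm hml).add_const (∫ u, ψ u * Real.log (u * y))
  have heq : ∀ᶠ S : ℝ in atTop,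
      2 * ∫ s in y..S, ∑' n : ℕ, (GG ψ ((n + 1) * s)).re / s =
      (∫ u, ψ u * ((harmonic ⌊u * S⌋₊ : ℝ) - Real.log (u * S))) + ∫ u, ψ u * Real.log (u * y) := by
    filter_upwards [eventually_ge_atTop y, eventually_ge_atTop (1 / m)] with S hyS hmS
    have hS : 0 < S := hy0.trans_le hyS
    have h1 := sum_int ψ hcψ hsupp hMr (fun u hu => hml u (hu.trans_lt hm)) hy0 hyS hyM'
    have hii : IntervalIntegrable (fun s => ∑' n : ℕ, (GG ψ ((n + 1) * s)).re / s) volume y S := by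
      rw [intervalIntegrable_iff_integrableOn_Ioc_of_le hyS]
      exact hInt.mono_set Set.Ioc_subset_Ioi_self
    have hii2 : IntervalIntegrable (fun s : ℝ => (∫ u, ψ u) * s⁻¹) volume y S := by
      refine ContinuousOn.intervalIntegrable ?_
      rw [Set.uIcc_of_le hyS]
      exact continuousOn_const.mul (continuousOn_id.inv₀ fun s hs => (hy0.trans_le hs.1).ne')
    have h2 : ∫ s in y..S, (1 / s) * (∑' n : ℕ, ψ ((n + 1) / s)) / s =
        ∫ s in y..S, (2 * (∑' n : ℕ, (GG ψ ((n + 1) * s)).re / s) + (∫ u, ψ u) * s⁻¹) := by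
      refine intervalIntegral.integral_congr fun s hs => ?_
      rw [Set.uIcc_of_le hyS] at hs
      have hs0 : 0 < s := hy0.trans_le hs.1
      have h3 := poisson_s ψ hψ hsupp hpos hs0
      have h4 : (1 / s) * (∑' n : ℕ, ψ ((n + 1) / s)) =
        2 * (∑' n : ℕ, (GG ψ ((n + 1) * s)).re) + ∫ u, ψ u := by linarith
      change (1 / s) * (∑' n : ℕ, ψ ((n + 1) / s)) / s = 2 * (∑' n : ℕ, (GG ψ ((n + 1) * s)).re / s) + (∫ u, ψ u) * s⁻¹
      rw [h4, tsum_div_const]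
      ring
    rw [intervalIntegral.integral_add (hii.const_mul 2) hii2, intervalIntegral.integral_const_mul,
      intervalIntegral.integral_const_mul, integral_inv_of_pos hy0 hS, h1] at h2
    have hD : Integrable (fun u => ψ u * ((harmonic ⌊u * S⌋₊ : ℝ) - Real.log (u * S))) :=
      Integrable.mono hiψ (D_meas ψ hcψ S) (Eventually.of_forall fun u => D_bound ψ hm hml hmS u)
    have h5 : ∫ u, ψ u * (harmonic ⌊u * S⌋₊ : ℝ) =
        ∫ u, ((ψ u * ((harmonic ⌊u * S⌋₊ : ℝ) - Real.log (u * S)) + ψ u * Real.log (u * y)) +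
          ψ u * Real.log (S / y)) := by
      congr 1
      ext u
      by_cases hu : u < m
      · simp [hml u hu]
      · have hu0 : 0 < u := hm.trans_le (not_lt.mp hu)
        rw [Real.log_mul hu0.ne' hS.ne', Real.log_mul hu0.ne' hy0.ne', Real.log_div hS.ne' hy0.ne']
        ring
    have hDL : Integrable (fun u => ψ u * ((harmonic ⌊u * S⌋₊ : ℝ) - Real.log (u * S)) +
        ψ u * Real.log (u * y)) := hD.add (log_integrable ψ hcψ hsupp hpos hy0)
    rw [integral_add hDL (hiψ.mul_const _),
      integral_add hD (log_integrable ψ hcψ hsupp hpos hy0), integral_mul_const] at h5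
    linarith
  have huniq := tendsto_nhds_unique (hL1.congr' heq) hL2
  rw [huniq, setIntegral_eq_integral_of_forall_compl_eq_zero]
  · rw [← integral_add (hiψ.mul_const _) (log_integrable ψ hcψ hsupp hpos hy0), eq_comm, sub_eq_zero]
    congr 1
    ext u
    ring
  · intro u hu
    rw [hml u (lt_of_le_of_lt (not_lt.mp hu) hm), mul_zero]
end

section
/- Let ψ : ℝ → ℝ be smooth with compact support in [1,2], T ≥ 2, and X = T^θ with 1 < θ < 2. Then ∫_0^∞ ψ(t/T) |∑_{n ≤ X} n^{−1/2−it}|² dt = T ψ̂(0)(log X + γ) + 2T Re ∫_{y}^∞ ⌊v/y⌋ ψ̂(v) dv/v + O(T^ε (X^{1/2} + X/T)) is consistent with the asymptotic T ∫_0^∞ ψ(t)(log(tT/2π) + 2γ) dt in the sense that: ψ̂(0)(log X + γ) + 2 Re ∫_y^∞ ⌊v/y⌋ ψ̂(v) dv/v − ∫_0^∞ ψ(t)(log(tT/2π) + 2γ) dt → 0 as T → ∞, where y = T/(2πX). -/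
open Complex Real MeasureTheory Filter

namespace SMC

/-- The primitive of `⌊w⌋ / w`. -/
noncomputable def Pf (w : ℝ) : ℝ := ⌊w⌋₊ * Real.log w - Real.log ((⌊w⌋₊).factorial : ℝ)

/-- The Stirling remainder. -/
noncomputable def Rf (w : ℝ) : ℝ :=
  w - Real.log w / 2 - Real.log (2 * Real.pi) / 2 - Pf w

lemma Pf_eq_sum (N : ℕ) (w : ℝ) (hw : 0 < w) (hN : w < N + 1) :
    Pf w = ∑ n ∈ Finset.Icc 1 N, max 0 (Real.log (w / n)) := by
  have hfl : ⌊w⌋₊ ≤ N := by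
    have : ⌊w⌋₊ < N + 1 := by
      rw [Nat.floor_lt hw.le]; push_cast; exact hN
    omega
  have hsub : Finset.Icc 1 ⌊w⌋₊ ⊆ Finset.Icc 1 N := Finset.Icc_subset_Icc_right hfl
  rw [← Finset.sum_subset hsub]
  · have h1 : ∀ n ∈ Finset.Icc 1 ⌊w⌋₊, max 0 (Real.log (w / n)) = Real.log w - Real.log n := by
      intro n hn
      rw [Finset.mem_Icc] at hn
      have hn0 : (0:ℝ) < n := by exact_mod_cast hn.1
      have : (n:ℝ) ≤ w := (Nat.le_floor_iff hw.le).1 hn.2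
      rw [max_eq_right, Real.log_div hw.ne' hn0.ne']
      apply Real.log_nonneg
      rw [le_div_iff₀ hn0]; linarith
    rw [Finset.sum_congr rfl h1, Finset.sum_sub_distrib]
    have h2 : ∀ m : ℕ, ∑ n ∈ Finset.Icc 1 m, Real.log n = Real.log (m.factorial : ℝ) := by
      intro m
      induction m with
      | zero => simp
      | succ k ih =>
        rw [Finset.sum_Icc_succ_top (by omega), ih, Nat.factorial_succ]
        push_cast
        rw [Real.log_mul (by positivity) (by positivity)]; ring
    rw [h2]; simp [Pf]
  · intro n hn hn'
    rw [Finset.mem_Icc] at hn hn'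
    have hn0 : (0:ℝ) < n := by exact_mod_cast hn.1
    have h : ⌊w⌋₊ < n := by omega
    rw [Nat.floor_lt hw.le] at h
    apply max_eq_left
    apply Real.log_nonpos (by positivity)
    rw [div_le_one hn0]; exact h.le

lemma Pf_continuousOn : ContinuousOn Pf (Set.Ioi 0) := by
  intro w hw
  have hw : 0 < w := hw
  apply ContinuousAt.continuousWithinAt
  obtain ⟨N, hN⟩ := exists_nat_gt w
  have hc : ContinuousAt (fun w : ℝ => ∑ n ∈ Finset.Icc 1 N, max 0 (Real.log (w / n))) w := by
    apply tendsto_finsetSum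
    intro n hn
    rw [Finset.mem_Icc] at hn
    have hn0 : (0:ℝ) < n := by exact_mod_cast hn.1
    have : ContinuousAt (fun w : ℝ => max 0 (Real.log (w / n))) w := by
      refine continuousAt_const.max (ContinuousAt.log ?_ (by positivity))
      exact continuousAt_id.div_const _
    exact this
  refine hc.congr ?_
  filter_upwards [lt_mem_nhds hw, gt_mem_nhds hN] with x hx hx'
  exact (Pf_eq_sum N x hx (by linarith)).symm

lemma Pf_deriv (w : ℝ) (hw : 0 < w) :
    HasDerivWithinAt Pf (⌊w⌋₊ / w) (Set.Ioi w) w := by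
  have h : HasDerivWithinAt
      (fun x : ℝ => ⌊w⌋₊ * Real.log x - Real.log ((⌊w⌋₊).factorial : ℝ)) (⌊w⌋₊ / w) (Set.Ioi w) w := by
    have := (((Real.hasDerivAt_log hw.ne').const_mul (⌊w⌋₊ : ℝ)).sub_const
      (Real.log ((⌊w⌋₊).factorial : ℝ))).hasDerivWithinAt (s := Set.Ioi w)
    simpa [div_eq_mul_inv] using this
  refine h.congr_of_eventuallyEq ?_ rfl
  have : ∀ᶠ x : ℝ in nhdsWithin w (Set.Ioi w), x < (⌊w⌋₊ : ℝ) + 1 :=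
    nhdsWithin_le_nhds (gt_mem_nhds (Nat.lt_floor_add_one w))
  filter_upwards [this, self_mem_nhdsWithin] with x hx hx'
  have hx' : w < x := hx'
  have : ⌊x⌋₊ = ⌊w⌋₊ := by
    rw [Nat.floor_eq_iff (by linarith)]
    exact ⟨(Nat.floor_le hw.le).trans hx'.le, hx⟩
  simp [Pf, this]

lemma Pf_lt_one (w : ℝ) (hw : w < 1) : Pf w = 0 := by
  have : ⌊w⌋₊ = 0 := Nat.floor_eq_zero.2 hw
  simp [Pf, this]

lemma Rf_nat (n : ℕ) (hn : 1 ≤ n) :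
    Rf n = Real.log (Stirling.stirlingSeq n) - Real.log (√Real.pi) := by
  have hn0 : (0:ℝ) < n := by exact_mod_cast hn
  rw [Stirling.log_stirlingSeq_formula, Real.log_sqrt Real.pi_pos.le, Rf, Pf]
  rw [Real.log_mul (by norm_num) hn0.ne', Real.log_mul (by norm_num) Real.pi_pos.ne',
    Real.log_div hn0.ne' (Real.exp_pos 1).ne', Real.log_exp]
  simp
  ring

lemma Rf_nat_tendsto : Tendsto (fun n : ℕ => Rf n) atTop (nhds 0) := by
  have h : Tendsto (fun n : ℕ => Real.log (Stirling.stirlingSeq n) - Real.log (√Real.pi)) atTop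
      (nhds (Real.log (√Real.pi) - Real.log (√Real.pi))) := by
    refine Tendsto.sub_const ?_ _
    exact Stirling.tendsto_stirlingSeq_sqrt_pi.log (by positivity)
  rw [sub_self] at h
  refine h.congr' ?_
  filter_upwards [eventually_ge_atTop 1] with n hn
  exact (Rf_nat n hn).symm

lemma Rf_diff (w : ℝ) (hw : 1 ≤ w) : |Rf w - Rf ⌊w⌋₊| ≤ 2 / ⌊w⌋₊ := by
  set n := ⌊w⌋₊ with hn
  have hn1 : 1 ≤ n := by rw [hn, Nat.one_le_floor_iff]; exact hw
  have hn0 : (0:ℝ) < n := by exact_mod_cast hn1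
  have hnw : (n:ℝ) ≤ w := Nat.floor_le (by linarith)
  have hwn : w < n + 1 := Nat.lt_floor_add_one w
  have hw0 : 0 < w := by linarith
  have e : Rf w - Rf n = (w - n) - (n + 1/2) * Real.log (w / n) := by
    rw [Real.log_div hw0.ne' hn0.ne', Rf, Rf, Pf, Pf, Nat.floor_natCast, ← hn]; ring
  have l1 : Real.log (w / n) ≤ w / n - 1 := Real.log_le_sub_one_of_pos (by positivity)
  have l2 : 1 - (w / n)⁻¹ ≤ Real.log (w / n) := Real.one_sub_inv_le_log_of_pos (by positivity)
  have a1 : w / n - 1 = (w - n) / n := by field_simp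
  have a2 : 1 - (w / n)⁻¹ = (w - n) / w := by field_simp
  rw [a1] at l1; rw [a2] at l2
  set t := w - n with ht
  have ht0 : 0 ≤ t := by linarith
  have ht1 : t ≤ 1 := by linarith
  have u1 : ((n:ℝ) + 1/2) * Real.log (w / n) ≤ t + 1 / n := by
    calc ((n:ℝ) + 1/2) * Real.log (w / n) ≤ (n + 1/2) * (t / n) := by gcongr
      _ = t + (t/2) / n := by field_simp
      _ ≤ t + 1 / n := by gcongr; linarith
  have u2 : t - 1 / n ≤ ((n:ℝ) + 1/2) * Real.log (w / n) := by
    calc t - 1 / n ≤ t - t * t / w := by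
          gcongr ?_ - ?_
          rw [div_le_div_iff₀ hw0 hn0]; nlinarith [mul_nonneg ht0 (sub_nonneg.2 ht1)]
      _ = n * (t / w) := by
          have : w = n + t := by linarith
          field_simp; rw [this]; ring
      _ ≤ (n + 1/2) * (t / w) := by
          have : 0 ≤ t / w := by positivity
          nlinarith
      _ ≤ _ := by gcongr
  have : (0:ℝ) ≤ 1 / n := by positivity
  have e2 : (2:ℝ) / n = 1 / n + 1 / n := by ring
  rw [e, abs_le, e2]; constructor <;> linarith

lemma Rf_tendsto : Tendsto Rf atTop (nhds 0) := by
  have hf : Tendsto (fun w : ℝ => ⌊w⌋₊) atTop atTop := tendsto_nat_floor_atTop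
  have h1 : Tendsto (fun w : ℝ => Rf (⌊w⌋₊ : ℝ)) atTop (nhds 0) := Rf_nat_tendsto.comp hf
  have h2 : Tendsto (fun w : ℝ => (2:ℝ) / (⌊w⌋₊ : ℝ)) atTop (nhds 0) :=
    (tendsto_const_div_atTop_nhds_zero_nat 2).comp hf
  have h3 : Tendsto (fun w : ℝ => Rf w - Rf (⌊w⌋₊ : ℝ)) atTop (nhds 0) := by
    refine squeeze_zero_norm' ?_ h2
    filter_upwards [eventually_ge_atTop 1] with w hw
    exact Rf_diff w hw
  simpa using h3.add h1

lemma Rf_bound : ∃ C : ℝ, 0 ≤ C ∧ ∀ w : ℝ, 1 ≤ w → |Rf w| ≤ C := by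
  obtain ⟨C, hC⟩ := (Metric.isBounded_range_of_tendsto _ Rf_nat_tendsto).exists_norm_le
  refine ⟨C + 2, ?_, ?_⟩
  · have := (norm_nonneg _).trans (hC (Rf (0:ℕ)) ⟨0, rfl⟩); linarith
  intro w hw
  have h1 := Rf_diff w hw
  have h2 : |Rf ⌊w⌋₊| ≤ C := hC _ ⟨⌊w⌋₊, rfl⟩
  have hn1 : 1 ≤ ⌊w⌋₊ := by rw [Nat.one_le_floor_iff]; exact hw
  have hn0 : (1:ℝ) ≤ ⌊w⌋₊ := by exact_mod_cast hn1
  have h3 : (2:ℝ) / ⌊w⌋₊ ≤ 2 := div_le_self (by norm_num) hn0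
  have := abs_add_le (Rf w - Rf ⌊w⌋₊) (Rf ⌊w⌋₊)
  rw [sub_add_cancel] at this
  linarith

/-- Global bound for the remainder. -/
lemma Rf_bound' : ∃ C : ℝ, 0 ≤ C ∧ ∀ w : ℝ, 0 < w →
    |Rf w| ≤ C + (if w < 1 then |Real.log w| else 0) := by
  obtain ⟨C, hC0, hC⟩ := Rf_bound
  refine ⟨C + 1 + |Real.log (2 * Real.pi)|, by positivity, fun w hw => ?_⟩
  split_ifs with h
  · rw [Rf, Pf_lt_one w h]
    have a := neg_abs_le (Real.log w)
    have a' := le_abs_self (Real.log w)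
    have b := neg_abs_le (Real.log (2 * Real.pi))
    have b' := le_abs_self (Real.log (2 * Real.pi))
    rw [abs_le]; constructor <;> linarith
  · have := hC w (by linarith)
    have b := abs_nonneg (Real.log (2 * Real.pi))
    linarith

lemma Pf_bound : ∃ C : ℝ, 0 ≤ C ∧ ∀ w : ℝ, 1 ≤ w → |Pf w| ≤ C * w := by
  obtain ⟨C, hC0, hC⟩ := Rf_bound
  refine ⟨C + 2 + |Real.log (2 * Real.pi)|, by positivity, fun w hw => ?_⟩
  have h1 := abs_le.1 (hC w hw)
  have e : Pf w = w - Real.log w / 2 - Real.log (2 * Real.pi) / 2 - Rf w := by rw [Rf]; ring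
  have l0 := Real.log_nonneg hw
  have l1 := Real.log_le_sub_one_of_pos (show 0 < w by linarith)
  have b := neg_abs_le (Real.log (2 * Real.pi))
  have b' := le_abs_self (Real.log (2 * Real.pi))
  have b0 := abs_nonneg (Real.log (2 * Real.pi))
  have : C + 2*w + |Real.log (2 * Real.pi)| ≤ (C + 2 + |Real.log (2 * Real.pi)|) * w := by
    nlinarith
  rw [e, abs_le]; constructor <;> linarith

lemma Pf_measurable : Measurable Pf := by
  unfold Pf
  have h1 : Measurable (fun w : ℝ => ((⌊w⌋₊ : ℕ) : ℝ)) :=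
    measurable_from_nat.comp Nat.measurable_floor
  have h2 : Measurable (fun w : ℝ => Real.log ((⌊w⌋₊).factorial : ℝ)) :=
    (measurable_from_nat (f := fun n : ℕ => Real.log (n.factorial : ℝ))).comp Nat.measurable_floor
  exact (h1.mul Real.measurable_log).sub h2

lemma Rf_measurable : Measurable Rf := by
  unfold Rf
  exact ((measurable_id.sub (Real.measurable_log.div_const _)).sub_const _).sub Pf_measurable


lemma log_integrable (D : ℝ → ℂ) (hDc : Continuous D)
    (h1 : IntegrableOn (fun v : ℝ => (v : ℂ) * D v) (Set.Ioi 0)) :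
    IntegrableOn (fun v : ℝ => (Real.log v : ℂ) * D v) (Set.Ioi 0) := by
  have hm : Measurable (fun v : ℝ => (Real.log v : ℂ)) :=
    Complex.measurable_ofReal.comp Real.measurable_log
  rw [← Set.Ioc_union_Ioi_eq_Ioi (zero_le_one' ℝ)]
  apply IntegrableOn.union
  · have hl : IntegrableOn (fun v : ℝ => (Real.log v : ℂ)) (Set.Ioc 0 1) := by
      have := (intervalIntegral.intervalIntegrable_log' (a := 0) (b := 1))
      rw [intervalIntegrable_iff_integrableOn_Ioc_of_le zero_le_one] at this
      exact this.ofReal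
    obtain ⟨C, hC⟩ := isCompact_Icc.exists_bound_of_continuousOn
      (hDc.continuousOn (s := Set.Icc (0:ℝ) 1))
    refine Integrable.mul_bdd (c := C) hl hDc.aestronglyMeasurable ?_
    rw [ae_restrict_iff' measurableSet_Ioc]
    exact Eventually.of_forall fun v hv => hC v ⟨hv.1.le, hv.2⟩
  · have h2 : IntegrableOn (fun v : ℝ => (v : ℂ) * D v) (Set.Ioi 1) :=
      h1.mono_set (Set.Ioi_subset_Ioi zero_le_one)
    refine Integrable.mono h2 (hm.aestronglyMeasurable.mul hDc.aestronglyMeasurable) ?_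
    rw [ae_restrict_iff' measurableSet_Ioi]
    refine Eventually.of_forall fun v hv => ?_
    have hv : 1 < v := hv
    rw [norm_mul, norm_mul, Complex.norm_real, Complex.norm_real, Real.norm_eq_abs,
      Real.norm_eq_abs, abs_of_nonneg (Real.log_nonneg hv.le), abs_of_pos (by linarith)]
    gcongr
    have := Real.log_le_sub_one_of_pos (show 0 < v by linarith)
    linarith

lemma int_of_mul (D : ℝ → ℂ) (hDc : Continuous D)
    (h1 : IntegrableOn (fun v : ℝ => (v : ℂ) * D v) (Set.Ioi 0)) :
    IntegrableOn D (Set.Ioi 0) := by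
  rw [← Set.Ioc_union_Ioi_eq_Ioi (zero_le_one' ℝ)]
  apply IntegrableOn.union
  · exact (hDc.integrableOn_Icc).mono_set Set.Ioc_subset_Icc_self
  · have h2 : IntegrableOn (fun v : ℝ => (v : ℂ) * D v) (Set.Ioi 1) :=
      h1.mono_set (Set.Ioi_subset_Ioi zero_le_one)
    refine Integrable.mono h2 hDc.aestronglyMeasurable ?_
    rw [ae_restrict_iff' measurableSet_Ioi]
    refine Eventually.of_forall fun v hv => ?_
    have hv : 1 < v := hv
    rw [norm_mul, Complex.norm_real, Real.norm_eq_abs, abs_of_pos (by linarith)]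
    nlinarith [norm_nonneg (D v)]

lemma Pf_scale_int (D : ℝ → ℂ) (hDc : Continuous D)
    (h1 : IntegrableOn (fun v : ℝ => (v : ℂ) * D v) (Set.Ioi 0)) (y : ℝ) (hy : 0 < y) :
    IntegrableOn (fun v : ℝ => (Pf (v / y) : ℂ) * D v) (Set.Ioi y) := by
  obtain ⟨C, hC0, hC⟩ := Pf_bound
  have hm : Measurable (fun v : ℝ => (Pf (v / y) : ℂ)) :=
    Complex.measurable_ofReal.comp (Pf_measurable.comp (measurable_id.div_const y))
  have h2 : IntegrableOn (fun v : ℝ => ((C / y : ℝ) : ℂ) * ((v : ℂ) * D v)) (Set.Ioi y) :=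
    (h1.mono_set (Set.Ioi_subset_Ioi hy.le)).const_mul _
  refine Integrable.mono h2 (hm.aestronglyMeasurable.mul hDc.aestronglyMeasurable) ?_
  rw [ae_restrict_iff' measurableSet_Ioi]
  refine Eventually.of_forall fun v hv => ?_
  have hv : y < v := hv
  have := hC (v / y) (by rw [le_div_iff₀ hy]; linarith)
  rw [norm_mul, norm_mul, norm_mul, Complex.norm_real, Complex.norm_real, Complex.norm_real,
    Real.norm_eq_abs, Real.norm_eq_abs, Real.norm_eq_abs, ← mul_assoc,
    abs_of_pos (show 0 < v by linarith), abs_of_nonneg (show 0 ≤ C / y by positivity)]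
  gcongr
  calc _ ≤ _ := this
    _ = _ := by ring

lemma parts (Φ D : ℝ → ℂ) (hΦ : ∀ v, HasDerivAt Φ (D v) v) (hDc : Continuous D)
    (hΦi : IntegrableOn Φ (Set.Ioi 0))
    (h1 : IntegrableOn (fun v : ℝ => (v : ℂ) * D v) (Set.Ioi 0))
    (hlim : Tendsto (fun v : ℝ => (v : ℂ) * Φ v) atTop (nhds 0)) (y : ℝ) (hy : 0 < y) :
    ∫ v in Set.Ioi y, ((⌊v / y⌋ : ℤ) : ℂ) * Φ v / v
      = - ∫ v in Set.Ioi y, (Pf (v / y) : ℂ) * D v := by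
  have hΦc : Continuous Φ := continuous_iff_continuousAt.2 fun v => (hΦ v).continuousAt
  have hfl : ∀ v : ℝ, 0 < v → ((⌊v / y⌋ : ℤ) : ℂ) = ((⌊v / y⌋₊ : ℕ) : ℂ) := by
    intro v hv
    rw [← Int.natCast_floor_eq_floor (show 0 ≤ v / y by positivity)]
    exact Int.cast_natCast _
  have e1 : ∫ v in Set.Ioi y, ((⌊v / y⌋ : ℤ) : ℂ) * Φ v / v
      = ∫ v in Set.Ioi y, ((((⌊v / y⌋₊ : ℕ) : ℝ) / v : ℝ) : ℂ) * Φ v := by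
    apply setIntegral_congr_fun measurableSet_Ioi
    intro v hv
    have hv : y < v := hv
    simp only [hfl v (by linarith)]
    push_cast; ring
  rw [e1]
  have hi1 : IntegrableOn (fun v : ℝ => ((((⌊v / y⌋₊ : ℕ) : ℝ) / v : ℝ) : ℂ) * Φ v)
      (Set.Ioi y) := by
    have hm : Measurable (fun v : ℝ => ((((⌊v / y⌋₊ : ℕ) : ℝ) / v : ℝ) : ℂ)) := by
      apply Complex.measurable_ofReal.comp
      refine Measurable.div ?_ measurable_id
      exact measurable_from_nat.comp (Nat.measurable_floor.comp (measurable_id.div_const y))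
    refine Integrable.bdd_mul (c := 1 / y) (hΦi.mono_set (Set.Ioi_subset_Ioi hy.le))
      hm.aestronglyMeasurable ?_
    rw [ae_restrict_iff' measurableSet_Ioi]
    refine Eventually.of_forall fun v hv => ?_
    have hv : y < v := hv
    have hv0 : 0 < v := by linarith
    rw [Complex.norm_real, Real.norm_eq_abs, abs_of_nonneg (by positivity), div_le_iff₀ hv0]
    calc _ ≤ v / y := Nat.floor_le (by positivity)
      _ = _ := by ring
  have hi2 := Pf_scale_int D hDc h1 y hy
  have hi := hi1.add hi2
  rw [eq_neg_iff_add_eq_zero, ← integral_add hi1 hi2]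
  have hcomp : ∀ b, y ≤ b → ∫ v in y..b, (((((⌊v / y⌋₊ : ℕ) : ℝ) / v : ℝ) : ℂ) * Φ v
      + (Pf (v / y) : ℂ) * D v) = (Pf (b / y) : ℂ) * Φ b := by
    intro b hb
    have := intervalIntegral.integral_eq_sub_of_hasDeriv_right_of_le hb
      (f := fun v => (Pf (v / y) : ℂ) * Φ v)
      (f' := fun v => ((((⌊v / y⌋₊ : ℕ) : ℝ) / v : ℝ) : ℂ) * Φ v + (Pf (v / y) : ℂ) * D v)
      ?_ ?_ ?_
    · rw [this]
      have : Pf (y / y) = 0 := by rw [div_self hy.ne']; simp [Pf]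
      simp [this]
    · refine ContinuousOn.mul ?_ hΦc.continuousOn
      refine Complex.continuous_ofReal.comp_continuousOn ?_
      refine Pf_continuousOn.comp (continuous_id.div_const y).continuousOn ?_
      intro v hv
      exact div_pos (lt_of_lt_of_le hy hv.1) hy
    · intro v hv
      have hv0 : 0 < v := hy.trans hv.1
      have hd : HasDerivWithinAt (fun v : ℝ => Pf (v / y)) (((⌊v / y⌋₊ : ℕ) : ℝ) / v)
          (Set.Ioi v) v := by
        have h := (Pf_deriv (v / y) (by positivity)).scomp v
          (h := fun v : ℝ => v / y) (h' := 1 / y) (s := Set.Ioi v)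
          ((hasDerivAt_id v).div_const y).hasDerivWithinAt
          (fun x hx => div_lt_div_of_pos_right hx hy)
        refine h.congr_deriv ?_
        rw [smul_eq_mul]; field_simp
      have hd' := hd.ofReal_comp
      exact hd'.mul (hΦ v).hasDerivWithinAt
    · rw [intervalIntegrable_iff_integrableOn_Ioc_of_le hb]
      exact hi.mono_set Set.Ioc_subset_Ioi_self
  have ht := intervalIntegral_tendsto_integral_Ioi y hi tendsto_id
  refine tendsto_nhds_unique ht ?_
  have h0 : Tendsto (fun b : ℝ => (Pf (b / y) : ℂ) * Φ b) atTop (nhds 0) := by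
    obtain ⟨C, hC0, hC⟩ := Pf_bound
    have hl : Tendsto (fun b : ℝ => (C / y) * ‖(b : ℂ) * Φ b‖) atTop (nhds 0) := by
      simpa using hlim.norm.const_mul (C / y)
    refine squeeze_zero_norm' ?_ hl
    filter_upwards [eventually_ge_atTop y] with v hv
    have := hC (v / y) (by rw [le_div_iff₀ hy]; linarith)
    rw [norm_mul, norm_mul, Complex.norm_real, Complex.norm_real,
      Real.norm_eq_abs, Real.norm_eq_abs, ← mul_assoc,
      abs_of_pos (show 0 < v by linarith)]
    gcongr
    calc _ ≤ _ := this
      _ = _ := by ring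
  refine h0.congr' ?_
  filter_upwards [eventually_ge_atTop y] with b hb
  exact (hcomp b hb).symm

lemma Rf_scale_bound : ∃ C : ℝ, 0 ≤ C ∧ ∀ v y : ℝ, 0 < v → 0 < y → y < 1 →
    |Rf (v / y)| ≤ C + |Real.log v| := by
  obtain ⟨C, hC0, hC⟩ := Rf_bound'
  refine ⟨C, hC0, fun v y hv hy hy1 => (hC (v / y) (by positivity)).trans ?_⟩
  gcongr
  split_ifs with h
  · rw [div_lt_one hy] at h
    rw [Real.log_div hv.ne' hy.ne']
    have a := Real.log_lt_log hv h
    have b := Real.log_neg hy hy1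
    rw [abs_of_neg (by linarith), abs_of_neg (by linarith)]
    linarith
  · positivity

lemma Rf_dom (D : ℝ → ℂ) (hDc : Continuous D)
    (h1 : IntegrableOn (fun v : ℝ => (v : ℂ) * D v) (Set.Ioi 0)) :
    ∃ b : ℝ → ℝ, IntegrableOn b (Set.Ioi 0) ∧ ∀ y : ℝ, 0 < y → y < 1 →
      ∀ᵐ v ∂(volume.restrict (Set.Ioi (0:ℝ))), ‖(Rf (v / y) : ℂ) * D v‖ ≤ b v := by
  obtain ⟨C, hC0, hC⟩ := Rf_scale_bound
  refine ⟨fun v => C * ‖D v‖ + ‖(Real.log v : ℂ) * D v‖,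
    ((int_of_mul D hDc h1).norm.const_mul C).add (log_integrable D hDc h1).norm, ?_⟩
  intro y hy hy1
  rw [ae_restrict_iff' measurableSet_Ioi]
  refine Eventually.of_forall fun v hv => ?_
  have := hC v y hv hy hy1
  show _ ≤ C * ‖D v‖ + ‖(Real.log v : ℂ) * D v‖
  rw [norm_mul, norm_mul, Complex.norm_real, Complex.norm_real, ← add_mul]
  gcongr
  exact this

lemma Rf_int_meas (D : ℝ → ℂ) (hDc : Continuous D) (y : ℝ) :
    AEStronglyMeasurable (fun v : ℝ => (Rf (v / y) : ℂ) * D v)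
      (volume.restrict (Set.Ioi (0:ℝ))) := by
  have hm : Measurable (fun v : ℝ => (Rf (v / y) : ℂ)) :=
    Complex.measurable_ofReal.comp (Rf_measurable.comp (measurable_id.div_const y))
  exact hm.aestronglyMeasurable.mul hDc.aestronglyMeasurable

lemma Rf_lim (D : ℝ → ℂ) (hDc : Continuous D)
    (h1 : IntegrableOn (fun v : ℝ => (v : ℂ) * D v) (Set.Ioi 0)) :
    Tendsto (fun y : ℝ => ∫ v in Set.Ioi (0:ℝ), (Rf (v / y) : ℂ) * D v)
      (nhdsWithin 0 (Set.Ioi 0)) (nhds 0) := by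
  obtain ⟨b, hb, hbd⟩ := Rf_dom D hDc h1
  have hsm : ∀ᶠ y : ℝ in nhdsWithin 0 (Set.Ioi 0), 0 < y ∧ y < 1 := by
    filter_upwards [self_mem_nhdsWithin, nhdsWithin_le_nhds (gt_mem_nhds (zero_lt_one' ℝ))]
      with y h h' using ⟨h, h'⟩
  have := tendsto_integral_filter_of_dominated_convergence
    (μ := volume.restrict (Set.Ioi (0:ℝ))) (l := nhdsWithin (0:ℝ) (Set.Ioi 0))
    (F := fun y v => (Rf (v / y) : ℂ) * D v) (f := fun _ => 0) b
    (Eventually.of_forall fun y => Rf_int_meas D hDc y)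
    (hsm.mono fun y h => hbd y h.1 h.2) hb ?_
  · simpa using this
  · rw [ae_restrict_iff' measurableSet_Ioi]
    refine Eventually.of_forall fun v hv => ?_
    have hv : 0 < v := hv
    have h1 : Tendsto (fun y : ℝ => v / y) (nhdsWithin 0 (Set.Ioi 0)) atTop := by
      simpa [div_eq_mul_inv] using tendsto_inv_nhdsGT_zero.const_mul_atTop hv
    have h2 := (Complex.continuous_ofReal.tendsto 0).comp (Rf_tendsto.comp h1)
    simpa using h2.mul_const (D v)

lemma expansion (Φ D : ℝ → ℂ) (hΦ : ∀ v, HasDerivAt Φ (D v) v) (hDc : Continuous D)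
    (hΦi : IntegrableOn Φ (Set.Ioi 0))
    (h1 : IntegrableOn (fun v : ℝ => (v : ℂ) * D v) (Set.Ioi 0))
    (hlim : Tendsto (fun v : ℝ => (v : ℂ) * Φ v) atTop (nhds 0)) (y : ℝ) (hy : 0 < y)
    (hy1 : y < 1) :
    ∫ v in Set.Ioi y, ((⌊v / y⌋ : ℤ) : ℂ) * Φ v / v
      = - ((1 / y : ℝ) : ℂ) * (∫ v in Set.Ioi (0:ℝ), (v : ℂ) * D v)
        + (1 / 2) * (∫ v in Set.Ioi (0:ℝ), (Real.log v : ℂ) * D v)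
        + (((Real.log (2 * Real.pi) - Real.log y) / 2 : ℝ) : ℂ) * (∫ v in Set.Ioi (0:ℝ), D v)
        + ∫ v in Set.Ioi (0:ℝ), (Rf (v / y) : ℂ) * D v := by
  rw [parts Φ D hΦ hDc hΦi h1 hlim y hy]
  have e0 : ∫ v in Set.Ioi y, (Pf (v / y) : ℂ) * D v
      = ∫ v in Set.Ioi (0:ℝ), (Pf (v / y) : ℂ) * D v := by
    symm
    refine setIntegral_eq_of_subset_of_ae_sdiff_eq_zero measurableSet_Ioi.nullMeasurableSet
      (Set.Ioi_subset_Ioi hy.le) ?_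
    refine Eventually.of_forall fun v hv => ?_
    have hv' : v ≤ y := by simpa using hv.2
    have : Pf (v / y) = 0 := by
      rcases hv'.lt_or_eq with h | h
      · exact Pf_lt_one _ (by rwa [div_lt_one hy])
      · rw [h, div_self hy.ne']; simp [Pf]
    simp [this]
  rw [e0]
  obtain ⟨b, hb, hbd⟩ := Rf_dom D hDc h1
  have iR : IntegrableOn (fun v : ℝ => (Rf (v / y) : ℂ) * D v) (Set.Ioi 0) :=
    Integrable.mono' hb (Rf_int_meas D hDc y) (hbd y hy hy1)
  have iL := log_integrable D hDc h1
  have iD := int_of_mul D hDc h1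
  rw [← integral_const_mul, ← integral_const_mul, ← integral_const_mul, ← integral_add,
    ← integral_add, ← integral_add, ← integral_neg]
  · apply setIntegral_congr_fun measurableSet_Ioi
    intro v hv
    have hv : 0 < v := hv
    have : Pf (v / y) = v / y - (Real.log v - Real.log y) / 2 - Real.log (2 * Real.pi) / 2
        - Rf (v / y) := by
      rw [Rf, Real.log_div hv.ne' hy.ne']; ring
    simp only [this]
    push_cast; ring
  · exact ((h1.const_mul _).add (iL.const_mul _)).add (iD.const_mul _)
  · exact iR
  · exact ((h1.const_mul _).add (iL.const_mul _))
  · exact iD.const_mul _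
  · exact h1.const_mul _
  · exact iL.const_mul _


lemma exp_int (n : ℕ) (z : ℂ) (hz : 0 < z.re) :
    IntegrableOn (fun v : ℝ => (v : ℂ) ^ n * Complex.exp (-z * v)) (Set.Ioi 0) := by
  have h := integrableOn_rpow_mul_exp_neg_mul_rpow (p := 1) (s := n) (b := z.re)
    (by have : (0:ℝ) ≤ n := by positivity
        linarith) zero_lt_one hz
  refine Integrable.mono h (by fun_prop) ?_
  rw [ae_restrict_iff' measurableSet_Ioi]
  refine Eventually.of_forall fun v hv => ?_
  have hv : 0 < v := hv
  rw [norm_mul, norm_mul, norm_pow, Complex.norm_real, Complex.norm_exp]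
  simp [abs_of_pos hv]

lemma lap_deriv (k : ℝ → ℂ) (hk : Measurable k)
    (h0 : ∀ z : ℂ, 0 < z.re → IntegrableOn (fun v : ℝ => k v * Complex.exp (-z * v)) (Set.Ioi 0))
    (h1 : ∀ z : ℂ, 0 < z.re →
      IntegrableOn (fun v : ℝ => k v * ((v : ℂ) * Complex.exp (-z * v))) (Set.Ioi 0))
    (z : ℂ) (hz : 0 < z.re) :
    HasDerivAt (fun z : ℂ => ∫ v in Set.Ioi (0:ℝ), k v * Complex.exp (-z * v))
      (∫ v in Set.Ioi (0:ℝ), k v * (-(v : ℂ) * Complex.exp (-z * v))) z := by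
  have hz2 : 0 < ((z.re / 2 : ℝ) : ℂ).re := by simpa using hz
  have hs : {w : ℂ | z.re / 2 < w.re} ∈ nhds z :=
    (isOpen_lt continuous_const Complex.continuous_re).mem_nhds (by simp; linarith)
  refine (hasDerivAt_integral_of_dominated_loc_of_deriv_le
    (F := fun (z : ℂ) (v : ℝ) => k v * Complex.exp (-z * v))
    (F' := fun (z : ℂ) (v : ℝ) => k v * (-(v : ℂ) * Complex.exp (-z * v)))
    (bound := fun v => ‖k v * ((v : ℂ) * Complex.exp (-((z.re / 2 : ℝ) : ℂ) * v))‖)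
    hs ?_ (h0 z hz) ?_ ?_ (h1 _ hz2).norm ?_).2
  · refine Eventually.of_forall fun w => ?_
    exact hk.aestronglyMeasurable.mul (by fun_prop)
  · exact hk.aestronglyMeasurable.mul (by fun_prop)
  · rw [ae_restrict_iff' measurableSet_Ioi]
    refine Eventually.of_forall fun v hv w hw => ?_
    have hv : 0 < v := hv
    have hw : z.re / 2 < w.re := hw
    simp only [norm_mul, norm_neg, Complex.norm_exp]
    have e1 : (-w * (v : ℂ)).re = -w.re * v := by simp
    have e2 : (-((z.re / 2 : ℝ) : ℂ) * (v : ℂ)).re = -(z.re / 2) * v := by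
      rw [← Complex.ofReal_neg, ← Complex.ofReal_mul, Complex.ofReal_re]
    rw [e1, e2]
    have e3 : -w.re * v ≤ -(z.re / 2) * v := by nlinarith
    have e4 := Real.exp_le_exp.2 e3
    gcongr
  · refine Eventually.of_forall fun v w _ => ?_
    have : HasDerivAt (fun w : ℂ => -w * (v : ℂ)) (-1 * (v : ℂ)) w :=
      ((hasDerivAt_id w).neg).mul_const _
    refine (this.cexp.const_mul (k v)).congr_deriv ?_
    ring

lemma lap_one (z : ℂ) (hz : 0 < z.re) :
    ∫ v in Set.Ioi (0:ℝ), Complex.exp (-z * v) = 1 / z := by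
  rw [integral_exp_mul_complex_Ioi (by simpa using hz)]
  simp

lemma lap_id (z : ℂ) (hz : 0 < z.re) :
    ∫ v in Set.Ioi (0:ℝ), (v : ℂ) * Complex.exp (-z * v) = 1 / z ^ 2 := by
  have hz0 : z ≠ 0 := by rintro rfl; simp at hz
  have h := lap_deriv (fun _ => 1) measurable_const
    (fun z hz => by simpa using exp_int 0 z hz) (fun z hz => by simpa using exp_int 1 z hz) z hz
  have h2 : HasDerivAt (fun z : ℂ => ∫ v in Set.Ioi (0:ℝ), 1 * Complex.exp (-z * v))
      (-1 / z ^ 2) z := by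
    have := hasDerivAt_inv hz0
    rw [neg_div, one_div]
    refine this.congr_of_eventuallyEq ?_
    have hs : {w : ℂ | 0 < w.re} ∈ nhds z :=
      (isOpen_lt continuous_const Complex.continuous_re).mem_nhds hz
    filter_upwards [hs] with w hw
    simp only [one_mul]
    rw [lap_one w hw, one_div]
  have := h.unique h2
  simp only [one_mul, neg_mul, integral_neg] at this
  simp only [neg_mul]
  rw [neg_div] at this
  exact neg_injective this

lemma log_exp_int (z : ℂ) (hz : 0 < z.re) :
    IntegrableOn (fun v : ℝ => (Real.log v : ℂ) * Complex.exp (-z * v)) (Set.Ioi 0) :=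
  log_integrable _ (by fun_prop) (by simpa using exp_int 1 z hz)

lemma lap_log_one :
    ∫ v in Set.Ioi (0:ℝ), (Real.log v : ℂ) * Complex.exp (-v)
      = -(Real.eulerMascheroniConstant : ℂ) := by
  have h := Complex.hasDerivAt_GammaIntegral (s := 1) (by simp)
  have h2 : HasDerivAt Complex.GammaIntegral (-(Real.eulerMascheroniConstant : ℂ)) 1 := by
    refine Complex.hasDerivAt_Gamma_one.congr_of_eventuallyEq ?_
    have hs : {w : ℂ | 0 < w.re} ∈ nhds (1:ℂ) :=
      (isOpen_lt continuous_const Complex.continuous_re).mem_nhds (by simp)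
    filter_upwards [hs] with w hw
    exact (Complex.Gamma_eq_integral hw).symm
  rw [← h.unique h2]
  apply setIntegral_congr_fun measurableSet_Ioi
  intro v hv
  simp

lemma lap_log_real (r : ℝ) (hr : 0 < r) :
    ∫ v in Set.Ioi (0:ℝ), (Real.log v : ℂ) * Complex.exp (-(r : ℂ) * v)
      = -((Real.eulerMascheroniConstant : ℂ) + Complex.log r) / r := by
  have h := integral_comp_mul_left_Ioi
    (fun t : ℝ => (Real.log t : ℂ) * Complex.exp (-t) - (Real.log r : ℂ) * Complex.exp (-t)) 0 hr
  rw [mul_zero] at h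
  have i1 : IntegrableOn (fun v : ℝ => (Real.log v : ℂ) * Complex.exp (-v)) (Set.Ioi 0) := by
    simpa using log_exp_int 1 (by simp)
  have i2 : IntegrableOn (fun v : ℝ => (Real.log r : ℂ) * Complex.exp (-v)) (Set.Ioi 0) := by
    have := exp_int 0 1 (by simp)
    simp only [pow_zero, one_mul, neg_mul] at this
    exact this.const_mul _
  have e := lap_one 1 (by simp)
  simp only [neg_mul, one_mul, div_one] at e
  rw [integral_sub i1 i2, lap_log_one, integral_const_mul, e] at h
  rw [← Complex.ofReal_log hr.le]
  have : ∫ v in Set.Ioi (0:ℝ), (Real.log v : ℂ) * Complex.exp (-(r : ℂ) * v)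
      = ∫ x in Set.Ioi (0:ℝ), ((Real.log (r * x) : ℂ) * Complex.exp (-((r * x : ℝ) : ℂ))
          - (Real.log r : ℂ) * Complex.exp (-((r * x : ℝ) : ℂ))) := by
    apply setIntegral_congr_fun measurableSet_Ioi
    intro v hv
    have hv : 0 < v := hv
    simp only [Real.log_mul hr.ne' hv.ne']
    push_cast
    ring_nf
  rw [this, h]
  rw [Complex.real_smul]
  have hr' : (r : ℂ) ≠ 0 := by exact_mod_cast hr.ne'
  push_cast
  field_simp
  ring

lemma lap_log (z : ℂ) (hz : 0 < z.re) :
    ∫ v in Set.Ioi (0:ℝ), (Real.log v : ℂ) * Complex.exp (-z * v)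
      = -((Real.eulerMascheroniConstant : ℂ) + Complex.log z) / z := by
  have hm : Measurable (fun v : ℝ => (Real.log v : ℂ)) :=
    Complex.measurable_ofReal.comp Real.measurable_log
  set U : Set ℂ := {w : ℂ | 0 < w.re}
  have hU : IsOpen U := isOpen_lt continuous_const Complex.continuous_re
  have hd : DifferentiableOn ℂ
      (fun z : ℂ => ∫ v in Set.Ioi (0:ℝ), (Real.log v : ℂ) * Complex.exp (-z * v)) U := by
    intro w hw
    refine (lap_deriv _ hm log_exp_int ?_ w hw).differentiableAt.differentiableWithinAt
    intro z hz
    refine log_integrable _ (by fun_prop) ?_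
    refine (exp_int 2 z hz).congr_fun (fun v _ => ?_) measurableSet_Ioi
    ring
  have hd2 : DifferentiableOn ℂ
      (fun z : ℂ => -((Real.eulerMascheroniConstant : ℂ) + Complex.log z) / z) U := by
    intro w hw
    have hw' : 0 < w.re := hw
    have hw0 : w ≠ 0 := by rintro rfl; simp at hw'
    have := Complex.differentiableAt_log (z := w) (Or.inl hw)
    exact ((((differentiableAt_const _).add this).neg).div differentiableAt_id
      hw0).differentiableWithinAt
  have hconv : Convex ℝ U := convex_halfSpace_re_gt 0
  refine (hd.analyticOnNhd hU).eqOn_of_preconnected_of_frequently_eq (hd2.analyticOnNhd hU)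
    hconv.isPreconnected (z₀ := 1) (by simp [U]) ?_ hz
  have ht : Tendsto (fun n : ℕ => ((1 + 1 / ((n : ℝ) + 1) : ℝ) : ℂ)) atTop
      (nhdsWithin 1 {1}ᶜ) := by
    rw [tendsto_nhdsWithin_iff]
    constructor
    · have := (Complex.continuous_ofReal.tendsto _).comp
        (tendsto_one_div_add_atTop_nhds_zero_nat (𝕜 := ℝ) |>.const_add 1)
      simpa [Function.comp_def] using this
    · refine Eventually.of_forall fun n => ?_
      have : (0:ℝ) < 1 / ((n:ℝ) + 1) := by positivity
      intro h
      rw [Set.mem_singleton_iff] at h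
      have h' : (1 + 1 / ((n : ℝ) + 1) : ℝ) = 1 := by exact_mod_cast h
      linarith
  refine ht.frequently (Frequently.of_forall fun n => ?_)
  exact lap_log_real _ (by positivity)


lemma supp_zero (ψ : ℝ → ℝ) (hs : tsupport ψ ⊆ Set.Icc 1 2) (u : ℝ) (hu : u ∉ Set.Icc (1:ℝ) 2) :
    ψ u = 0 := by
  by_contra h
  exact hu (hs (subset_tsupport ψ h))

/-- The transform of a compactly supported smooth function is Schwartz. -/
lemma schwartz_of (f : ℝ → ℂ) (hf : ContDiff ℝ (⊤ : ℕ∞) f) (hc : HasCompactSupport f) :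
    ∃ F : SchwartzMap ℝ ℂ, ∀ v : ℝ,
      F v = ∫ u : ℝ, f u * Complex.exp (2 * Real.pi * Complex.I * u * v) := by
  refine ⟨FourierTransformInv.fourierInv (hc.toSchwartzMap hf), fun v => ?_⟩
  rw [SchwartzMap.fourierInv_coe, Real.fourierInv_eq']
  congr 1
  ext u
  simp only [HasCompactSupport.toSchwartzMap_toFun, smul_eq_mul]
  rw [mul_comm]
  congr 2
  simp
  ring

lemma transform_deriv (f : ℝ → ℂ) (hf : Continuous f) (hc : HasCompactSupport f) (v : ℝ) :
    HasDerivAt (fun v : ℝ => ∫ u : ℝ, f u * Complex.exp (2 * Real.pi * Complex.I * u * v))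
      (∫ u : ℝ, (2 * Real.pi * Complex.I * u * f u) *
        Complex.exp (2 * Real.pi * Complex.I * u * v)) v := by
  have hc' : HasCompactSupport (fun u : ℝ => 2 * Real.pi * Complex.I * u * f u) :=
    hc.mul_left
  have hn : ∀ u v : ℝ, ‖Complex.exp (2 * Real.pi * Complex.I * u * v)‖ = 1 := by
    intro u v
    rw [show (2 * Real.pi * Complex.I * u * v : ℂ) = ((2 * Real.pi * u * v : ℝ) : ℂ) * Complex.I by
      push_cast; ring]
    exact Complex.norm_exp_ofReal_mul_I _
  have hi : Integrable (fun u : ℝ => 2 * Real.pi * Complex.I * u * f u) :=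
    Continuous.integrable_of_hasCompactSupport (by fun_prop) hc'
  refine (hasDerivAt_integral_of_dominated_loc_of_deriv_le
    (F := fun (v u : ℝ) => f u * Complex.exp (2 * Real.pi * Complex.I * u * v))
    (F' := fun (v u : ℝ) => (2 * Real.pi * Complex.I * u * f u) *
        Complex.exp (2 * Real.pi * Complex.I * u * v))
    (bound := fun u => ‖2 * Real.pi * Complex.I * u * f u‖)
    Filter.univ_mem ?_ ?_ ?_ ?_ hi.norm ?_).2
  · exact Eventually.of_forall fun w => Continuous.aestronglyMeasurable (by fun_prop)
  · exact Continuous.integrable_of_hasCompactSupport (by fun_prop) hc.mul_right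
  · exact Continuous.aestronglyMeasurable (by fun_prop)
  · refine Eventually.of_forall fun u w _ => ?_
    rw [norm_mul, hn, mul_one]
  · refine Eventually.of_forall fun u w _ => ?_
    have : HasDerivAt (fun w : ℝ => 2 * Real.pi * Complex.I * u * (w : ℂ))
        (2 * Real.pi * Complex.I * u * 1) w := (Complex.ofRealCLM.hasDerivAt).const_mul _
    refine (this.cexp.const_mul (f u)).congr_deriv ?_
    ring

/-- Abel summation evaluation of `∫ k D`. -/
lemma abel (g : ℝ → ℂ) (hg : Continuous g) (hgs : ∀ u, u ∉ Set.Icc (1:ℝ) 2 → g u = 0)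
    (k : ℝ → ℂ) (hk : Measurable k) (K : ℂ → ℂ) (hK : ContinuousOn K Complex.slitPlane)
    (hke : ∀ z : ℂ, 0 < z.re →
      IntegrableOn (fun v : ℝ => k v * Complex.exp (-z * v)) (Set.Ioi 0))
    (hL : ∀ z : ℂ, 0 < z.re → ∫ v in Set.Ioi (0:ℝ), k v * Complex.exp (-z * v) = K z)
    (D : ℝ → ℂ) (hD : ∀ v : ℝ, D v = ∫ u : ℝ, g u * Complex.exp (2 * Real.pi * Complex.I * u * v))
    (hDc : Continuous D)
    (hkD : IntegrableOn (fun v : ℝ => k v * D v) (Set.Ioi 0)) :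
    ∫ v in Set.Ioi (0:ℝ), k v * D v = ∫ u : ℝ, g u * K (-(2 * Real.pi * Complex.I * u)) := by
  have hgc : HasCompactSupport g :=
    HasCompactSupport.of_support_subset_isCompact isCompact_Icc (fun u hu => by
      by_contra h; exact hu (hgs u h))
  have hgi : Integrable g := hg.integrable_of_hasCompactSupport hgc
  have hn : ∀ u v : ℝ, ‖Complex.exp (2 * Real.pi * Complex.I * u * v)‖ = 1 := by
    intro u v
    rw [show (2 * Real.pi * Complex.I * u * v : ℂ) = ((2 * Real.pi * u * v : ℝ) : ℂ) * Complex.I by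
      push_cast; ring]
    exact Complex.norm_exp_ofReal_mul_I _
  have hfub : ∀ δ : ℝ, 0 < δ →
      ∫ v in Set.Ioi (0:ℝ), (k v * D v) * Complex.exp (-(δ : ℂ) * v)
        = ∫ u : ℝ, g u * K (δ - 2 * Real.pi * Complex.I * u) := by
    intro δ hδ
    have hδ' : 0 < (δ : ℂ).re := by simpa using hδ
    have hprod : Integrable (fun p : ℝ × ℝ => ((k p.1 * Complex.exp (-(δ : ℂ) * p.1)) * g p.2) *
        Complex.exp (2 * Real.pi * Complex.I * p.2 * p.1))
        ((volume.restrict (Set.Ioi (0:ℝ))).prod volume) := by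
      refine Integrable.mul_bdd (c := 1) ((hke δ hδ').mul_prod hgi) ?_ ?_
      · exact Continuous.aestronglyMeasurable (by fun_prop)
      · exact Eventually.of_forall fun p => (hn p.2 p.1).le
    have hsw := integral_integral_swap (f := fun v u : ℝ =>
      ((k v * Complex.exp (-(δ : ℂ) * v)) * g u) *
        Complex.exp (2 * Real.pi * Complex.I * u * v)) hprod
    have el : ∫ v in Set.Ioi (0:ℝ), (k v * D v) * Complex.exp (-(δ : ℂ) * v)
        = ∫ v in Set.Ioi (0:ℝ), ∫ u : ℝ, ((k v * Complex.exp (-(δ : ℂ) * v)) * g u) *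
        Complex.exp (2 * Real.pi * Complex.I * u * v) := by
      congr 1
      ext v
      simp_rw [mul_assoc (k v * Complex.exp (-(δ : ℂ) * v))]
      rw [integral_const_mul, ← hD]
      ring
    rw [el, hsw]
    congr 1
    ext u
    rw [← hL _ (by simpa using hδ), ← integral_const_mul]
    congr 1
    ext v
    rw [show -((δ : ℂ) - 2 * Real.pi * Complex.I * u) * v
      = -(δ : ℂ) * v + 2 * Real.pi * Complex.I * u * v by ring, Complex.exp_add]
    ring
  have lim1 : Tendsto (fun δ : ℝ => ∫ v in Set.Ioi (0:ℝ), (k v * D v) * Complex.exp (-(δ : ℂ) * v))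
      (nhdsWithin 0 (Set.Ioi 0)) (nhds (∫ v in Set.Ioi (0:ℝ), k v * D v)) := by
    refine tendsto_integral_filter_of_dominated_convergence (fun v => ‖k v * D v‖) ?_ ?_
      hkD.norm ?_
    · refine Eventually.of_forall fun δ => ?_
      exact hkD.aestronglyMeasurable.mul (Continuous.aestronglyMeasurable (by fun_prop))
    · filter_upwards [self_mem_nhdsWithin] with δ hδ
      have hδ : 0 < δ := hδ
      rw [ae_restrict_iff' measurableSet_Ioi]
      refine Eventually.of_forall fun v hv => ?_
      have hv : 0 < v := hv
      rw [norm_mul]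
      refine mul_le_of_le_one_right (norm_nonneg _) ?_
      rw [Complex.norm_exp, Real.exp_le_one_iff]
      simp
      positivity
    · refine Eventually.of_forall fun v => ?_
      have : Continuous (fun δ : ℝ => (k v * D v) * Complex.exp (-(δ : ℂ) * v)) := by fun_prop
      have := (this.tendsto 0).mono_left (nhdsWithin_le_nhds (s := Set.Ioi 0))
      simpa using this
  have hsp : ∀ δ u : ℝ, 1 ≤ u → ((δ : ℂ) - 2 * Real.pi * Complex.I * u) ∈ Complex.slitPlane := by
    intro δ u hu
    right
    have : ((δ : ℂ) - 2 * Real.pi * Complex.I * u).im = -(2 * Real.pi * u) := by simp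
    rw [this]
    have : 0 < 2 * Real.pi * u := by positivity
    linarith
  have lim2 : Tendsto (fun δ : ℝ => ∫ u : ℝ, g u * K (δ - 2 * Real.pi * Complex.I * u))
      (nhdsWithin 0 (Set.Ioi 0))
      (nhds (∫ u : ℝ, g u * K (-(2 * Real.pi * Complex.I * u)))) := by
    have hcont : ContinuousOn (fun p : ℝ × ℝ => K ((p.1 : ℂ) - 2 * Real.pi * Complex.I * p.2))
        (Set.Icc 0 1 ×ˢ Set.Icc 1 2) := by
      refine hK.comp (Continuous.continuousOn (by fun_prop)) ?_
      intro p hp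
      exact hsp _ _ hp.2.1
    obtain ⟨C, hC⟩ := (isCompact_Icc.prod isCompact_Icc).exists_bound_of_continuousOn hcont
    have hsm : ∀ᶠ y : ℝ in nhdsWithin 0 (Set.Ioi 0), 0 < y ∧ y < 1 := by
      filter_upwards [self_mem_nhdsWithin, nhdsWithin_le_nhds (gt_mem_nhds (zero_lt_one' ℝ))]
        with y h h' using ⟨h, h'⟩
    refine tendsto_integral_filter_of_dominated_convergence (fun u => ‖g u‖ * C) ?_ ?_
      (hgi.norm.mul_const C) ?_
    · filter_upwards [hsm] with δ hδ
      have hco : ContinuousOn (fun u : ℝ => g u * K (δ - 2 * Real.pi * Complex.I * u))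
          (Set.Icc 1 2) := by
        refine hg.continuousOn.mul (hK.comp (Continuous.continuousOn (by fun_prop)) ?_)
        intro u hu
        exact hsp _ _ hu.1
      have : Integrable (fun u : ℝ => g u * K (δ - 2 * Real.pi * Complex.I * u)) := by
        rw [← integrableOn_iff_integrable_of_support_subset (s := Set.Icc 1 2)]
        · exact hco.integrableOn_Icc
        · intro u hu
          by_contra h
          exact hu (by simp [hgs u h])
      exact this.aestronglyMeasurable
    · filter_upwards [hsm] with δ hδ
      refine Eventually.of_forall fun u => ?_
      by_cases hu : u ∈ Set.Icc (1:ℝ) 2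
      · rw [norm_mul]
        gcongr
        exact hC (δ, u) ⟨⟨hδ.1.le, hδ.2.le⟩, hu⟩
      · simp [hgs u hu]
    · refine Eventually.of_forall fun u => ?_
      by_cases hu : u ∈ Set.Icc (1:ℝ) 2
      · refine Tendsto.const_mul _ ?_
        have h0 := hsp 0 u hu.1
        have hKc : ContinuousAt K (((0:ℝ) : ℂ) - 2 * Real.pi * Complex.I * u) :=
          hK.continuousAt (Complex.isOpen_slitPlane.mem_nhds h0)
        have hc : Continuous (fun δ : ℝ => (δ : ℂ) - 2 * Real.pi * Complex.I * u) := by fun_prop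
        have := (hKc.tendsto.comp (hc.tendsto 0)).mono_left (nhdsWithin_le_nhds (s := Set.Ioi 0))
        simpa [Function.comp_def] using this
      · simp [hgs u hu]
  refine tendsto_nhds_unique lim1 (lim2.congr' ?_)
  filter_upwards [self_mem_nhdsWithin] with δ hδ
  exact (hfub δ hδ).symm


lemma psi_log_int (ψ : ℝ → ℝ) (hψc : Continuous ψ) (hs : tsupport ψ ⊆ Set.Icc 1 2) :
    Integrable (fun u : ℝ =>
      ψ u * (Real.eulerMascheroniConstant + Real.log (2 * Real.pi * u))) := by
  rw [← integrableOn_iff_integrable_of_support_subset (s := Set.Icc 1 2)]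
  · refine ContinuousOn.integrableOn_Icc ?_
    refine hψc.continuousOn.mul (continuousOn_const.add (ContinuousOn.log (by fun_prop) ?_))
    intro u hu
    have : 0 < u := by linarith [hu.1]
    positivity
  · intro u hu
    by_contra h
    exact hu (by simp [supp_zero ψ hs u h])

lemma core (ψ : ℝ → ℝ) (hψ : ContDiff ℝ (⊤ : ℕ∞) ψ) (hsupp : HasCompactSupport ψ)
    (hs : tsupport ψ ⊆ Set.Icc 1 2) :
    ∃ E : ℝ → ℝ, Tendsto E (nhdsWithin 0 (Set.Ioi 0)) (nhds 0) ∧ ∀ y : ℝ, 0 < y → y < 1 →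
      2 * (∫ v in Set.Ioi y, ((⌊v / y⌋ : ℤ) : ℂ) *
        (∫ u : ℝ, (ψ u : ℂ) * Complex.exp (2 * Real.pi * Complex.I * u * v)) / v).re
      = (∫ u : ℝ, ψ u * (Real.eulerMascheroniConstant + Real.log (2 * Real.pi * u)))
        + (Real.log y - Real.log (2 * Real.pi)) * (∫ u : ℝ, ψ u) + E y := by
  have hψc : Continuous ψ := hψ.continuous
  have hfs : ContDiff ℝ (⊤ : ℕ∞) (fun u : ℝ => (ψ u : ℂ)) := Complex.ofRealCLM.contDiff.comp hψ
  have hfc : HasCompactSupport (fun u : ℝ => (ψ u : ℂ)) :=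
    hsupp.comp_left (g := fun x : ℝ => (x : ℂ)) Complex.ofReal_zero
  have hgs : ContDiff ℝ (⊤ : ℕ∞) (fun u : ℝ => 2 * Real.pi * Complex.I * u * (ψ u : ℂ)) :=
    (contDiff_const.mul Complex.ofRealCLM.contDiff).mul hfs
  have hgc : HasCompactSupport (fun u : ℝ => 2 * Real.pi * Complex.I * u * (ψ u : ℂ)) :=
    hfc.mul_left
  obtain ⟨Φ, hΦ⟩ := schwartz_of _ hfs hfc
  obtain ⟨D, hD⟩ := schwartz_of _ hgs hgc
  have hder : ∀ v, HasDerivAt Φ (D v) v := by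
    intro v
    have := transform_deriv _ hfs.continuous hfc v
    rw [← hD] at this
    rwa [show (Φ : ℝ → ℂ) = _ from funext hΦ]
  have hDc : Continuous D := D.continuous
  have h1 : IntegrableOn (fun v : ℝ => (v : ℂ) * D v) (Set.Ioi 0) := by
    have := D.integrable_pow_mul volume 1
    refine Integrable.integrableOn ?_
    refine Integrable.mono this (Continuous.aestronglyMeasurable (by fun_prop)) ?_
    exact Eventually.of_forall fun v => by simp
  have hΦi : IntegrableOn Φ (Set.Ioi 0) := Φ.integrable.integrableOn
  obtain ⟨C, hC⟩ := Φ.decay 2 0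
  have hlim : Tendsto (fun v : ℝ => (v : ℂ) * Φ v) atTop (nhds 0) := by
    have hl : Tendsto (fun v : ℝ => C / v) atTop (nhds 0) := tendsto_const_nhds.div_atTop tendsto_id
    refine squeeze_zero_norm' ?_ hl
    filter_upwards [eventually_gt_atTop 0] with v hv
    have := hC.2 v
    rw [norm_iteratedFDeriv_zero, Real.norm_eq_abs, abs_of_pos hv] at this
    rw [norm_mul, Complex.norm_real, Real.norm_eq_abs, abs_of_pos hv, le_div_iff₀ hv]
    linarith
  have hΦ0 : Φ 0 = ((∫ u : ℝ, ψ u : ℝ) : ℂ) := by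
    rw [hΦ, ← integral_complex_ofReal]
    simp
  have hlimΦ : Tendsto Φ atTop (nhds 0) := by
    refine squeeze_zero_norm' ?_ (by simpa using hlim.norm)
    filter_upwards [eventually_ge_atTop 1] with v hv
    rw [abs_of_pos (show 0 < v by linarith)]
    nlinarith [norm_nonneg (Φ v)]
  have I0 : ∫ v in Set.Ioi (0:ℝ), D v = -((∫ u : ℝ, ψ u : ℝ) : ℂ) := by
    rw [integral_Ioi_of_hasDerivAt_of_tendsto' (fun v _ => hder v) (int_of_mul D hDc h1) hlimΦ,
      hΦ0, zero_sub]
  have hgz : ∀ u, u ∉ Set.Icc (1:ℝ) 2 → 2 * Real.pi * Complex.I * u * (ψ u : ℂ) = 0 := by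
    intro u hu
    simp [supp_zero ψ hs u hu]
  have I1 : (∫ v in Set.Ioi (0:ℝ), (v : ℂ) * D v).re = 0 := by
    rw [abel _ hgs.continuous hgz (fun v => (v : ℂ)) Complex.measurable_ofReal
      (fun z => 1 / z ^ 2) ?_ (fun z hz => by simpa using exp_int 1 z hz) lap_id D hD hDc h1]
    · have : ∀ u : ℝ, 2 * Real.pi * Complex.I * u * (ψ u : ℂ)
          * (1 / (-(2 * Real.pi * Complex.I * u)) ^ 2)
          = ((-(2 * Real.pi * u * ψ u / (2 * Real.pi * u) ^ 2) : ℝ) : ℂ) * Complex.I := by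
        intro u
        have : (-(2 * Real.pi * Complex.I * u)) ^ 2 = -((2 * Real.pi * u : ℂ)) ^ 2 := by
          linear_combination (4 * (Real.pi : ℂ) ^ 2 * u ^ 2) * Complex.I_sq
        rw [this]
        push_cast
        rw [one_div, inv_neg]
        ring
      simp_rw [this]
      rw [integral_mul_const, integral_complex_ofReal]
      simp
    · refine continuousOn_const.div (by fun_prop) ?_
      intro z hz
      exact pow_ne_zero _ (Complex.slitPlane_ne_zero hz)
  have hm : Measurable (fun v : ℝ => (Real.log v : ℂ)) :=
    Complex.measurable_ofReal.comp Real.measurable_log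
  have IL : (∫ v in Set.Ioi (0:ℝ), (Real.log v : ℂ) * D v).re
      = ∫ u : ℝ, ψ u * (Real.eulerMascheroniConstant + Real.log (2 * Real.pi * u)) := by
    rw [abel _ hgs.continuous hgz (fun v => (Real.log v : ℂ)) hm
      (fun z => -((Real.eulerMascheroniConstant : ℂ) + Complex.log z) / z) ?_ log_exp_int
      lap_log D hD hDc (log_integrable D hDc h1)]
    · have : ∀ u : ℝ, 2 * Real.pi * Complex.I * u * (ψ u : ℂ)
          * (-((Real.eulerMascheroniConstant : ℂ) + Complex.log (-(2 * Real.pi * Complex.I * u)))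
            / (-(2 * Real.pi * Complex.I * u)))
          = ((ψ u * (Real.eulerMascheroniConstant + Real.log (2 * Real.pi * u)) : ℝ) : ℂ)
            + ((ψ u : ℝ) : ℂ) * (((-(Real.pi / 2) : ℝ) : ℂ) * Complex.I) := by
        intro u
        by_cases hu : u ∈ Set.Icc (1:ℝ) 2
        · have hu0 : 0 < u := by linarith [hu.1]
          have hu' : (u : ℂ) ≠ 0 := by exact_mod_cast hu0.ne'
          have hpi : (Real.pi : ℂ) ≠ 0 := by exact_mod_cast Real.pi_ne_zero
          have hl : Complex.log (-(2 * Real.pi * Complex.I * u))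
              = (Real.log (2 * Real.pi * u) : ℂ) - (Real.pi / 2) * Complex.I := by
            have : -(2 * Real.pi * Complex.I * u) = ((2 * Real.pi * u : ℝ) : ℂ) * (-Complex.I) := by
              push_cast; ring
            rw [this, Complex.log_ofReal_mul (by positivity) (by simp), Complex.log_neg_I]
            ring
          rw [hl]
          push_cast
          have hI := Complex.I_ne_zero
          field_simp
          ring
        · simp [supp_zero ψ hs u hu]
      simp_rw [this]
      rw [integral_add, integral_complex_ofReal, integral_mul_const, integral_complex_ofReal]
      · simp
      · exact (psi_log_int ψ hψc hs).ofReal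
      · exact ((hψc.integrable_of_hasCompactSupport hsupp).ofReal).mul_const _
    · refine ContinuousOn.div ?_ continuousOn_id (fun z hz => Complex.slitPlane_ne_zero hz)
      exact (continuousOn_const.add (fun z hz =>
        (continuousAt_clog hz).continuousWithinAt)).neg
  refine ⟨fun y => 2 * (∫ v in Set.Ioi (0:ℝ), (Rf (v / y) : ℂ) * D v).re, ?_, ?_⟩
  · have := (Complex.continuous_re.tendsto _).comp (Rf_lim D hDc h1)
    simpa [Function.comp_def] using this.const_mul 2
  · intro y hy hy1
    have := expansion Φ D hder hDc hΦi h1 hlim y hy hy1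
    simp_rw [hΦ] at this
    rw [this, I0]
    simp only [Complex.add_re]
    rw [← Complex.ofReal_neg, ← Complex.ofReal_neg, Complex.re_ofReal_mul, I1,
      show (1 / 2 : ℂ) = ((1 / 2 : ℝ) : ℂ) by norm_num, Complex.re_ofReal_mul, IL,
      Complex.re_ofReal_mul, Complex.ofReal_re]
    ring

end SMC

theorem second_moment_consistency (ψ : ℝ → ℝ)
    (hψ : ContDiff ℝ (⊤ : ℕ∞) ψ) (hsupp : HasCompactSupport ψ)
    (hsupp12 : tsupport ψ ⊆ Set.Icc 1 2)
    (θ : ℝ) (hθ1 : 1 < θ) (hθ2 : θ < 2) :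
    Tendsto (fun T : ℝ =>
        (∫ u : ℝ, (ψ u : ℂ) * Complex.exp (2 * Real.pi * Complex.I * u * 0)).re *
            (Real.log (T ^ θ) + Real.eulerMascheroniConstant)
          + 2 * (∫ v in Set.Ioi (T / (2 * Real.pi * T ^ θ)),
              ((⌊v / (T / (2 * Real.pi * T ^ θ))⌋ : ℤ) : ℂ) *
                (∫ u : ℝ, (ψ u : ℂ) * Complex.exp (2 * Real.pi * Complex.I * u * v)) / v).re
          - ∫ t in Set.Ioi (0 : ℝ),
              ψ t * (Real.log (t * T / (2 * Real.pi)) + 2 * Real.eulerMascheroniConstant))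
      atTop (nhds 0) := by
  obtain ⟨E, hE, hcore⟩ := SMC.core ψ hψ hsupp hsupp12
  have hψc : Continuous ψ := hψ.continuous
  have hy : Tendsto (fun T : ℝ => T / (2 * Real.pi * T ^ θ)) atTop
      (nhdsWithin 0 (Set.Ioi 0)) := by
    rw [tendsto_nhdsWithin_iff]
    constructor
    · have h := (tendsto_rpow_neg_atTop (show 0 < θ - 1 by linarith)).const_mul (1 / (2 * Real.pi))
      rw [mul_zero] at h
      refine h.congr' ?_
      filter_upwards [eventually_gt_atTop 0] with T hT
      rw [neg_sub, Real.rpow_sub hT, Real.rpow_one]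
      have : 0 < T ^ θ := by positivity
      field_simp
    · filter_upwards [eventually_gt_atTop 0] with T hT
      have : 0 < T ^ θ := by positivity
      rw [Set.mem_Ioi]
      positivity
  have hy1 : ∀ᶠ T : ℝ in atTop, T / (2 * Real.pi * T ^ θ) < 1 :=
    (hy.mono_right nhdsWithin_le_nhds).eventually (gt_mem_nhds zero_lt_one)
  refine (hE.comp hy).congr' ?_
  filter_upwards [eventually_gt_atTop 0, hy1] with T hT hT1
  have hTθ : 0 < T ^ θ := by positivity
  have hy0 : 0 < T / (2 * Real.pi * T ^ θ) := by positivity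
  rw [hcore _ hy0 hT1]
  have e0 : (∫ u : ℝ, (ψ u : ℂ) * Complex.exp (2 * Real.pi * Complex.I * u * 0)).re
      = ∫ u : ℝ, ψ u := by
    rw [← Complex.ofReal_re (∫ u : ℝ, ψ u), ← integral_complex_ofReal]
    simp
  have i1 : Integrable (fun u : ℝ =>
      ψ u * (Real.eulerMascheroniConstant + Real.log (2 * Real.pi * u))) := by
    exact SMC.psi_log_int ψ hψc hsupp12
  have i2 : Integrable ψ := hψc.integrable_of_hasCompactSupport hsupp
  have e1 : ∫ t in Set.Ioi (0 : ℝ),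
        ψ t * (Real.log (t * T / (2 * Real.pi)) + 2 * Real.eulerMascheroniConstant)
      = (∫ u : ℝ, ψ u * (Real.eulerMascheroniConstant + Real.log (2 * Real.pi * u)))
        + (Real.eulerMascheroniConstant + Real.log T - 2 * Real.log (2 * Real.pi))
          * ∫ u : ℝ, ψ u := by
    rw [setIntegral_eq_integral_of_forall_compl_eq_zero, ← integral_const_mul,
      ← integral_add i1 (i2.const_mul _)]
    · congr 1
      ext u
      by_cases hu : u ∈ Set.Icc (1:ℝ) 2
      · have hu0 : 0 < u := by linarith [hu.1]
        rw [Real.log_div (by positivity) (by positivity), Real.log_mul hu0.ne' hT.ne',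
          Real.log_mul (show 2 * Real.pi ≠ 0 by positivity) hu0.ne']
        ring
      · simp [SMC.supp_zero ψ hsupp12 u hu]
    · intro u hu
      rw [SMC.supp_zero ψ hsupp12 u (fun h => hu (show (0:ℝ) < u by linarith [h.1])), zero_mul]
  rw [e0, e1, Real.log_div hT.ne' (by positivity), Real.log_mul (by positivity) hTθ.ne']
  simp only [Function.comp_apply]
  ring
end
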